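/- arXiv:1607.05790 — 13 statements merged into one kernel-verified Lean document; each statement's English description precedes it below -/
import Mathlib

section
/- Let L > 0 and let u : ℝ≥0 × [0,L] → ℝ be a smooth solution of the short pulse equation u_{tx} = u + (1/6)(u³)_{xx}. Suppose the boundary condition (u(t,L))²·√(1+(u_x(t,L))²)/2 − (u(t,0))²·√(1+(u_x(t,0))²)/2 = 0 holds for every t ≥ 0. Then the total arc-length S(u(t)) = ∫₀ᴸ √(1 + (u_x(t,x))²) dx satisfies (d/dt) S(u(t)) = 0 for every t ≥ 0. -/
open Real

/-- Partial derivative in the first (time) variable. -/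
noncomputable def pt (f : ℝ → ℝ → ℝ) (t x : ℝ) : ℝ := deriv (fun τ => f τ x) t

/-- Partial derivative in the second (space) variable. -/
noncomputable def px (f : ℝ → ℝ → ℝ) (t x : ℝ) : ℝ := deriv (fun y => f t y) x

theorem aux_hasDeriv_x {f : ℝ → ℝ → ℝ} (hf : Differentiable ℝ (Function.uncurry f)) (t x : ℝ) :
    HasDerivAt (fun y => f t y) (fderiv ℝ (Function.uncurry f) (t, x) (0, 1)) x := by
  have h := (hf (t, x)).hasFDerivAt
  have h2 : HasDerivAt (fun y : ℝ => (t, y)) ((0 : ℝ), (1 : ℝ)) x :=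
    (hasDerivAt_const x t).prodMk (hasDerivAt_id x)
  exact h.comp_hasDerivAt x h2

theorem aux_hasDeriv_t {f : ℝ → ℝ → ℝ} (hf : Differentiable ℝ (Function.uncurry f)) (t x : ℝ) :
    HasDerivAt (fun τ => f τ x) (fderiv ℝ (Function.uncurry f) (t, x) (1, 0)) t := by
  have h := (hf (t, x)).hasFDerivAt
  have h2 : HasDerivAt (fun y : ℝ => (y, x)) ((1 : ℝ), (0 : ℝ)) t :=
    (hasDerivAt_id t).prodMk (hasDerivAt_const t x)
  exact h.comp_hasDerivAt t h2

theorem aux_px_eq {f : ℝ → ℝ → ℝ} (hf : Differentiable ℝ (Function.uncurry f)) :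
    Function.uncurry (px f) = fun p => fderiv ℝ (Function.uncurry f) p (0, 1) := by
  funext p
  exact (aux_hasDeriv_x hf p.1 p.2).deriv

theorem aux_pt_eq {f : ℝ → ℝ → ℝ} (hf : Differentiable ℝ (Function.uncurry f)) :
    Function.uncurry (pt f) = fun p => fderiv ℝ (Function.uncurry f) p (1, 0) := by
  funext p
  exact (aux_hasDeriv_t hf p.1 p.2).deriv

theorem aux_diff {f : ℝ → ℝ → ℝ} (hf : ContDiff ℝ (⊤ : ℕ∞) (Function.uncurry f)) :
    Differentiable ℝ (Function.uncurry f) := hf.differentiable (by simp)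

theorem aux_fd {f : ℝ → ℝ → ℝ} (hf : ContDiff ℝ (⊤ : ℕ∞) (Function.uncurry f)) :
    ContDiff ℝ (⊤ : ℕ∞) (fderiv ℝ (Function.uncurry f)) :=
  hf.fderiv_right (m := (⊤ : ℕ∞)) (by norm_cast)

theorem aux_px_smooth {f : ℝ → ℝ → ℝ} (hf : ContDiff ℝ (⊤ : ℕ∞) (Function.uncurry f)) :
    ContDiff ℝ (⊤ : ℕ∞) (Function.uncurry (px f)) := by
  rw [aux_px_eq (aux_diff hf)]
  exact (aux_fd hf).clm_apply contDiff_const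

theorem aux_pt_smooth {f : ℝ → ℝ → ℝ} (hf : ContDiff ℝ (⊤ : ℕ∞) (Function.uncurry f)) :
    ContDiff ℝ (⊤ : ℕ∞) (Function.uncurry (pt f)) := by
  rw [aux_pt_eq (aux_diff hf)]
  exact (aux_fd hf).clm_apply contDiff_const

theorem aux_hx {f : ℝ → ℝ → ℝ} (hf : ContDiff ℝ (⊤ : ℕ∞) (Function.uncurry f)) (t x : ℝ) :
    HasDerivAt (fun y => f t y) (px f t x) x :=
  (aux_hasDeriv_x (aux_diff hf) t x).differentiableAt.hasDerivAt

theorem aux_ht {f : ℝ → ℝ → ℝ} (hf : ContDiff ℝ (⊤ : ℕ∞) (Function.uncurry f)) (t x : ℝ) :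
    HasDerivAt (fun τ => f τ x) (pt f t x) t :=
  (aux_hasDeriv_t (aux_diff hf) t x).differentiableAt.hasDerivAt

theorem aux_symm {f : ℝ → ℝ → ℝ} (hf : ContDiff ℝ (⊤ : ℕ∞) (Function.uncurry f)) (t x : ℝ) :
    pt (px f) t x = px (pt f) t x := by
  have hd := aux_diff hf
  have hfd : DifferentiableAt ℝ (fderiv ℝ (Function.uncurry f)) (t, x) :=
    (aux_fd hf).differentiable (by simp) (t, x)
  have h1 : pt (px f) t x = fderiv ℝ (Function.uncurry (px f)) (t, x) (1, 0) :=
    congrFun (aux_pt_eq (aux_diff (aux_px_smooth hf))) (t, x)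
  have h2 : px (pt f) t x = fderiv ℝ (Function.uncurry (pt f)) (t, x) (0, 1) :=
    congrFun (aux_px_eq (aux_diff (aux_pt_smooth hf))) (t, x)
  have e1 := (hfd.hasFDerivAt.clm_apply
    (hasFDerivAt_const ((0 : ℝ), (1 : ℝ)) (t, x))).fderiv
  have e2 := (hfd.hasFDerivAt.clm_apply
    (hasFDerivAt_const ((1 : ℝ), (0 : ℝ)) (t, x))).fderiv
  rw [h1, h2, aux_px_eq hd, aux_pt_eq hd, e1, e2]
  simpa using second_derivative_symmetric (fun y => (hd y).hasFDerivAt) hfd.hasFDerivAt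
    ((1 : ℝ), (0 : ℝ)) ((0 : ℝ), (1 : ℝ))

theorem aux_sqrt {g : ℝ → ℝ} {g' x : ℝ} (h : HasDerivAt g g' x) :
    HasDerivAt (fun y => Real.sqrt (1 + (g y)^2)) (g x * g' / Real.sqrt (1 + (g x)^2)) x := by
  have hp : (0 : ℝ) < 1 + (g x)^2 := by positivity
  convert ((h.fun_pow 2).const_add 1).sqrt hp.ne' using 1
  have := (Real.sqrt_pos.2 hp).ne'
  simp only [Nat.add_one_sub_one, pow_one]
  push_cast
  field_simp

theorem aux_cube {f : ℝ → ℝ → ℝ} (hf : ContDiff ℝ (⊤ : ℕ∞) (Function.uncurry f)) (t x : ℝ) :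
    px (px (fun τ y => (f τ y)^3)) t x
      = 6 * f t x * (px f t x)^2 + 3 * (f t x)^2 * px (px f) t x := by
  have h : px (fun τ y => (f τ y)^3) = fun τ y => 3 * (f τ y)^2 * px f τ y := by
    funext τ y
    have := ((aux_hx hf τ y).fun_pow 3).deriv
    simpa [px] using this
  rw [h]
  have h2 := ((((aux_hx hf t x).pow 2).const_mul 3).mul (aux_hx (aux_px_smooth hf) t x)).deriv
  refine Eq.trans h2 ?_
  simp
  ring

theorem aux_integral {G G' : ℝ → ℝ → ℝ} (hG : Continuous (Function.uncurry G))
    (hG' : Continuous (Function.uncurry G'))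
    (hd : ∀ t x, HasDerivAt (fun τ => G τ x) (G' t x) t) (L t : ℝ) :
    HasDerivAt (fun τ => ∫ x in (0:ℝ)..L, G τ x) (∫ x in (0:ℝ)..L, G' t x) t := by
  have hc : ∀ τ, Continuous (G τ) := fun τ => hG.comp (Continuous.prodMk_right τ)
  have hc' : ∀ τ, Continuous (G' τ) := fun τ => hG'.comp (Continuous.prodMk_right τ)
  obtain ⟨C, hC⟩ := ((isCompact_closedBall t 1).prod (isCompact_uIcc (a := (0:ℝ)) (b := L))).exists_bound_of_continuousOn
    hG'.continuousOn
  refine (intervalIntegral.hasDerivAt_integral_of_dominated_loc_of_deriv_le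
    (bound := fun _ => C) (Metric.closedBall_mem_nhds t one_pos)
    (Filter.Eventually.of_forall fun τ => (hc τ).aestronglyMeasurable)
    ((hc t).intervalIntegrable _ _) (hc' t).aestronglyMeasurable ?_ (by simp) ?_).2
  · exact Filter.Eventually.of_forall fun x hx τ hτ =>
      hC (τ, x) ⟨hτ, Set.uIoc_subset_uIcc hx⟩
  · exact Filter.Eventually.of_forall fun x _ τ _ => hd τ x

/-- If `u` is a smooth solution of the short pulse equation
`u_{tx} = u + (1/6)(u³)_{xx}` on `ℝ≥0 × [0,L]` whose boundary values satisfy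
`[u² √(1+u_x²)/2]₀ᴸ = 0`, then the total arc-length
`S(u(t)) = ∫₀ᴸ √(1+(u_x(t,x))²) dx` is constant in time. -/
theorem arclength_conservation_short_pulse
    (L : ℝ) (hL : 0 < L) (u : ℝ → ℝ → ℝ)
    (hu : ContDiff ℝ (⊤ : ℕ∞) (Function.uncurry u))
    (hpde : ∀ t ≥ (0:ℝ), ∀ x ∈ Set.Icc (0:ℝ) L,
      px (pt u) t x = u t x + (1/6) * px (px (fun τ y => (u τ y)^3)) t x)
    (hbc : ∀ t ≥ (0:ℝ),
      (u t L)^2 * Real.sqrt (1 + (px u t L)^2) / 2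
        - (u t 0)^2 * Real.sqrt (1 + (px u t 0)^2) / 2 = 0) :
    ∀ t ≥ (0:ℝ),
      deriv (fun τ => ∫ x in (0:ℝ)..L, Real.sqrt (1 + (px u τ x)^2)) t = 0 := by
  intro t ht
  have hx := aux_px_smooth hu
  have hpos : ∀ τ x, 0 < Real.sqrt (1 + (px u τ x)^2) := fun τ x =>
    Real.sqrt_pos.2 (by positivity)
  have c1 : Continuous (fun p : ℝ × ℝ => px u p.1 p.2) := hx.continuous
  have c2 : Continuous (fun p : ℝ × ℝ => pt (px u) p.1 p.2) := (aux_pt_smooth hx).continuous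
  have cs : Continuous (fun p : ℝ × ℝ => Real.sqrt (1 + (px u p.1 p.2)^2)) := by fun_prop
  have cd : Continuous (fun p : ℝ × ℝ =>
      px u p.1 p.2 * pt (px u) p.1 p.2 / Real.sqrt (1 + (px u p.1 p.2)^2)) :=
    (c1.mul c2).div cs fun p => (hpos _ _).ne'
  have key := aux_integral (G := fun τ x => Real.sqrt (1 + (px u τ x)^2))
    (G' := fun τ x => px u τ x * pt (px u) τ x / Real.sqrt (1 + (px u τ x)^2))
    cs cd (fun τ x => aux_sqrt (aux_ht hx τ x)) L t
  rw [key.deriv]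
  refine Eq.trans ?_ (hbc t ht)
  refine intervalIntegral.integral_eq_sub_of_hasDerivAt
    (f := fun x => (u t x)^2 * Real.sqrt (1 + (px u t x)^2) / 2) ?_
    ((cd.comp (Continuous.prodMk_right t)).intervalIntegrable _ _)
  intro x hxL
  rw [Set.uIcc_of_le hL.le] at hxL
  have hp := hpde t ht x hxL
  rw [aux_cube hu, ← aux_symm hu] at hp
  have hD := ((((aux_hx hu t x).pow 2).mul (aux_sqrt (aux_hx hx t x))).div_const 2)
  refine hD.congr_deriv ?_
  rw [hp]
  have hne := (hpos t x).ne'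
  have hsq : Real.sqrt (1 + (px u t x)^2) ^ 2 = 1 + (px u t x)^2 := Real.sq_sqrt (by positivity)
  simp only [Pi.pow_apply]
  generalize Real.sqrt (1 + (px u t x)^2) = s at *
  field_simp
  push_cast
  simp only [hsq, Nat.add_one_sub_one, pow_one]
  ring
end

section
/- Let θ : ℝ≥0 × ℝ → ℝ be a smooth solution of the sine-Gordon equation θ_{τs} = sin θ. Let x, u : ℝ≥0 × ℝ → ℝ be smooth functions defined by the hodograph transformation x(τ,s) = x(τ,0) + ∫₀ˢ cos θ(τ,σ) dσ and u(τ,s) = u(τ,0) + ∫₀ˢ sin θ(τ,σ) dσ, where the base point satisfies x_τ(τ,0) = −(θ_τ(τ,0))²/2 and u(τ,0) = θ_τ(τ,0) for all τ ≥ 0. Then (x,u) is a solution of the parametrized form of the short pulse equation x_s(u_{τs} x_s − x_{τs} u_s) = u·x_s·(x_s² + u_s²) + (x_τ + u²/2)(u_{ss} x_s − x_{ss} u_s). -/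
open Real

/-- Partial derivative in the first (time) variable `τ`. -/
noncomputable def pτ (f : ℝ → ℝ → ℝ) (t s : ℝ) : ℝ := deriv (fun τ => f τ s) t

/-- Partial derivative in the second (space) variable `s`. -/
noncomputable def ps (f : ℝ → ℝ → ℝ) (t s : ℝ) : ℝ := deriv (fun σ => f t σ) s

/-- The parametrized form of the short pulse equation at `(τ, s)`. -/
def ParamSPE (x u : ℝ → ℝ → ℝ) (τ s : ℝ) : Prop :=
  ps x τ s * (pτ (ps u) τ s * ps x τ s - pτ (ps x) τ s * ps u τ s)
    = u τ s * ps x τ s * ((ps x τ s)^2 + (ps u τ s)^2)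
      + (pτ x τ s + (u τ s)^2 / 2)
        * (ps (ps u) τ s * ps x τ s - ps (ps x) τ s * ps u τ s)

abbrev Sm (f : ℝ → ℝ → ℝ) : Prop := ContDiff ℝ (⊤ : ℕ∞) (Function.uncurry f)

lemma hasτ {f : ℝ → ℝ → ℝ} (hf : Sm f) (t s : ℝ) :
    HasDerivAt (fun τ => f τ s) (fderiv ℝ (Function.uncurry f) (t, s) (1, 0)) t := by
  have h1 : HasFDerivAt (Function.uncurry f) (fderiv ℝ (Function.uncurry f) (t, s)) (t, s) :=
    ((hf.differentiable (by simp)) (t, s)).hasFDerivAt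
  have h2 : HasDerivAt (fun τ : ℝ => (τ, s)) ((1 : ℝ), (0 : ℝ)) t :=
    (hasDerivAt_id t).prodMk (hasDerivAt_const t s)
  exact h1.comp_hasDerivAt t h2

lemma hasS {f : ℝ → ℝ → ℝ} (hf : Sm f) (t s : ℝ) :
    HasDerivAt (fun σ => f t σ) (fderiv ℝ (Function.uncurry f) (t, s) (0, 1)) s := by
  have h1 : HasFDerivAt (Function.uncurry f) (fderiv ℝ (Function.uncurry f) (t, s)) (t, s) :=
    ((hf.differentiable (by simp)) (t, s)).hasFDerivAt
  have h2 : HasDerivAt (fun σ : ℝ => (t, σ)) ((0 : ℝ), (1 : ℝ)) s :=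
    (hasDerivAt_const s t).prodMk (hasDerivAt_id s)
  exact h1.comp_hasDerivAt s h2

lemma eqτ {f : ℝ → ℝ → ℝ} (hf : Sm f) :
    Function.uncurry (pτ f) = fun p => fderiv ℝ (Function.uncurry f) p (1, 0) := by
  funext ⟨t, s⟩
  exact (hasτ hf t s).deriv

lemma eqS {f : ℝ → ℝ → ℝ} (hf : Sm f) :
    Function.uncurry (ps f) = fun p => fderiv ℝ (Function.uncurry f) p (0, 1) := by
  funext ⟨t, s⟩
  exact (hasS hf t s).deriv

lemma dτ {f : ℝ → ℝ → ℝ} (hf : Sm f) (t s : ℝ) :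
    HasDerivAt (fun τ => f τ s) (pτ f t s) t := by
  have h := hasτ hf t s
  rw [← h.deriv] at h
  exact h

lemma dS {f : ℝ → ℝ → ℝ} (hf : Sm f) (t s : ℝ) :
    HasDerivAt (fun σ => f t σ) (ps f t s) s := by
  have h := hasS hf t s
  rw [← h.deriv] at h
  exact h

lemma smFd {f : ℝ → ℝ → ℝ} (hf : Sm f) :
    ContDiff ℝ (⊤ : ℕ∞) (fderiv ℝ (Function.uncurry f)) :=
  hf.fderiv_right (by simp)

lemma smτ {f : ℝ → ℝ → ℝ} (hf : Sm f) : Sm (pτ f) := by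
  unfold Sm
  rw [eqτ hf]
  exact (smFd hf).clm_apply contDiff_const

lemma smS {f : ℝ → ℝ → ℝ} (hf : Sm f) : Sm (ps f) := by
  unfold Sm
  rw [eqS hf]
  exact (smFd hf).clm_apply contDiff_const

lemma clairaut {f : ℝ → ℝ → ℝ} (hf : Sm f) (t s : ℝ) :
    ps (pτ f) t s = pτ (ps f) t s := by
  have h1 : ps (pτ f) t s = fderiv ℝ (Function.uncurry (pτ f)) (t, s) (0, 1) :=
    (hasS (smτ hf) t s).deriv
  have h2 : pτ (ps f) t s = fderiv ℝ (Function.uncurry (ps f)) (t, s) (1, 0) :=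
    (hasτ (smS hf) t s).deriv
  have hd : HasFDerivAt (fderiv ℝ (Function.uncurry f))
      (fderiv ℝ (fderiv ℝ (Function.uncurry f)) (t, s)) (t, s) :=
    (((smFd hf).differentiable (by simp)) (t, s)).hasFDerivAt
  have hsym : IsSymmSndFDerivAt ℝ (Function.uncurry f) (t, s) :=
    hf.contDiffAt.isSymmSndFDerivAt (by
      simp only [minSmoothness_of_isRCLikeNormedField]
      exact WithTop.coe_le_coe.2 (le_top : (2 : ℕ∞) ≤ ⊤))
  rw [h1, h2, eqτ hf, eqS hf]
  have e1 := (hd.clm_apply (hasFDerivAt_const ((1 : ℝ), (0 : ℝ)) (t, s))).fderiv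
  have e2 := (hd.clm_apply (hasFDerivAt_const ((0 : ℝ), (1 : ℝ)) (t, s))).fderiv
  rw [e1, e2]
  simpa using hsym.eq (0, 1) (1, 0)

lemma oneSided {f g : ℝ → ℝ} {a b t : ℝ} (ht : 0 ≤ t) (hf : HasDerivAt f a t)
    (hg : HasDerivAt g b t) (h : ∀ τ ≥ (0:ℝ), f τ = g τ) : a = b := by
  have h1 : HasDerivWithinAt f a (Set.Ici 0) t := hf.hasDerivWithinAt
  have h2 : HasDerivWithinAt f b (Set.Ici 0) t :=
    hg.hasDerivWithinAt.congr (fun y hy => h y hy) (h t ht)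
  exact (uniqueDiffOn_Ici (0:ℝ) t ht).eq_deriv _ h1 h2

lemma constEq {f g f' : ℝ → ℝ} (hf : ∀ s, HasDerivAt f (f' s) s)
    (hg : ∀ s, HasDerivAt g (f' s) s) (h0 : f 0 = g 0) (s : ℝ) : f s = g s := by
  have h : ∀ s, HasDerivAt (fun s => f s - g s) 0 s := fun s =>
    ((hf s).sub (hg s)).congr_deriv (sub_self _)
  have := is_const_of_deriv_eq_zero (fun s => (h s).differentiableAt) (fun s => (h s).deriv) s 0
  linarith

/-- A smooth solution of the sine-Gordon equation `θ_{τs} = sin θ`, transformed by the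
hodograph transformation with base point satisfying `x_τ(τ,0) = −(θ_τ(τ,0))²/2` and
`u(τ,0) = θ_τ(τ,0)`, yields a solution `(x,u)` of the parametrized short pulse equation. -/
theorem sineGordon_to_paramSPE
    (θ x u : ℝ → ℝ → ℝ)
    (hθ : ContDiff ℝ (⊤ : ℕ∞) (Function.uncurry θ))
    (hx : ContDiff ℝ (⊤ : ℕ∞) (Function.uncurry x))
    (hu : ContDiff ℝ (⊤ : ℕ∞) (Function.uncurry u))
    (hsg : ∀ τ ≥ (0:ℝ), ∀ s : ℝ, pτ (ps θ) τ s = Real.sin (θ τ s))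
    (hhx : ∀ τ ≥ (0:ℝ), ∀ s : ℝ,
      x τ s = x τ 0 + ∫ σ in (0:ℝ)..s, Real.cos (θ τ σ))
    (hhu : ∀ τ ≥ (0:ℝ), ∀ s : ℝ,
      u τ s = u τ 0 + ∫ σ in (0:ℝ)..s, Real.sin (θ τ σ))
    (hbase₁ : ∀ τ ≥ (0:ℝ), pτ x τ 0 = -(pτ θ τ 0)^2 / 2)
    (hbase₂ : ∀ τ ≥ (0:ℝ), u τ 0 = pτ θ τ 0) :
    ∀ τ ≥ (0:ℝ), ∀ s : ℝ, ParamSPE x u τ s := by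
  have hcθ : ∀ τ, Continuous (fun σ => θ τ σ) := fun τ =>
    continuous_iff_continuousAt.2 fun s => (dS hθ τ s).continuousAt
  have hxs : ∀ τ ≥ (0:ℝ), ∀ s, ps x τ s = Real.cos (θ τ s) := by
    intro τ hτ s
    have hc : Continuous (fun σ => Real.cos (θ τ σ)) := Real.continuous_cos.comp (hcθ τ)
    have h := ((hc.integral_hasStrictDerivAt 0 s).hasDerivAt).const_add (x τ 0)
    have e : (fun σ => x τ σ) = fun σ => x τ 0 + ∫ r in (0:ℝ)..σ, Real.cos (θ τ r) :=
      funext (hhx τ hτ)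
    unfold ps
    rw [e]
    exact h.deriv
  have hus : ∀ τ ≥ (0:ℝ), ∀ s, ps u τ s = Real.sin (θ τ s) := by
    intro τ hτ s
    have hc : Continuous (fun σ => Real.sin (θ τ σ)) := Real.continuous_sin.comp (hcθ τ)
    have h := ((hc.integral_hasStrictDerivAt 0 s).hasDerivAt).const_add (u τ 0)
    have e : (fun σ => u τ σ) = fun σ => u τ 0 + ∫ r in (0:ℝ)..σ, Real.sin (θ τ r) :=
      funext (hhu τ hτ)
    unfold ps
    rw [e]
    exact h.deriv
  have hxts : ∀ τ ≥ (0:ℝ), ∀ s, pτ (ps x) τ s = -Real.sin (θ τ s) * pτ θ τ s :=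
    fun τ hτ s => oneSided hτ (dτ (smS hx) τ s) (dτ hθ τ s).cos (fun r hr => hxs r hr s)
  have huts : ∀ τ ≥ (0:ℝ), ∀ s, pτ (ps u) τ s = Real.cos (θ τ s) * pτ θ τ s :=
    fun τ hτ s => oneSided hτ (dτ (smS hu) τ s) (dτ hθ τ s).sin (fun r hr => hus r hr s)
  intro τ hτ
  have hu_eq : ∀ s, u τ s = pτ θ τ s := by
    refine constEq (f' := fun s => Real.sin (θ τ s)) (fun s => ?_) (fun s => ?_) (hbase₂ τ hτ)
    · have h := dS hu τ s
      rwa [hus τ hτ s] at h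
    · have h := dS (smτ hθ) τ s
      rwa [clairaut hθ, hsg τ hτ s] at h
  have hx_eq : ∀ s, pτ x τ s = -(pτ θ τ s)^2 / 2 := by
    refine constEq (f' := fun s => -Real.sin (θ τ s) * pτ θ τ s) (fun s => ?_) (fun s => ?_)
      (hbase₁ τ hτ)
    · have h := dS (smτ hx) τ s
      rwa [clairaut hx, hxts τ hτ s] at h
    · have h := dS (smτ hθ) τ s
      rw [clairaut hθ, hsg τ hτ s] at h
      refine (((h.pow 2).neg).div_const 2).congr_deriv ?_
      norm_num
      ring
  intro s
  have hz : pτ x τ s + (u τ s)^2 / 2 = 0 := by rw [hx_eq, hu_eq]; ring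
  unfold ParamSPE
  rw [hz, hxs τ hτ, hus τ hτ, hxts τ hτ, huts τ hτ, hu_eq]
  ring
end

section
/- Let θ : ℝ≥0 × ℝ → ℝ be a smooth solution of the sine-Gordon equation θ_{τs} = sin θ, and let x, u be defined by the hodograph transformation x(τ,s) = x(τ,0) + ∫₀ˢ cos θ(τ,σ) dσ, u(τ,s) = u(τ,0) + ∫₀ˢ sin θ(τ,σ) dσ, with base point satisfying x_τ(τ,0) = −(θ_τ(τ,0))²/2 and u(τ,0) = θ_τ(τ,0) for all τ ≥ 0. Then for all τ ≥ 0 and all s ∈ ℝ, x_τ(τ,s) = −(θ_τ(τ,s))²/2 and u(τ,s) = θ_τ(τ,s). -/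
open Real

lemma aux_pτ (f : ℝ → ℝ → ℝ) (hf : ContDiff ℝ (⊤ : ℕ∞) (Function.uncurry f)) (t s : ℝ) :
    HasDerivAt (fun τ => f τ s) (fderiv ℝ (Function.uncurry f) (t, s) (1, 0)) t := by
  have h1 : HasFDerivAt (Function.uncurry f) (fderiv ℝ (Function.uncurry f) (t, s)) (t, s) :=
    ((hf.differentiable (by simp)) (t, s)).hasFDerivAt
  have h2 : HasDerivAt (fun τ : ℝ => (τ, s)) ((1 : ℝ), (0 : ℝ)) t :=
    (hasDerivAt_id t).prodMk (hasDerivAt_const t s)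
  exact h1.comp_hasDerivAt t h2

lemma aux_ps (f : ℝ → ℝ → ℝ) (hf : ContDiff ℝ (⊤ : ℕ∞) (Function.uncurry f)) (t s : ℝ) :
    HasDerivAt (fun σ => f t σ) (fderiv ℝ (Function.uncurry f) (t, s) (0, 1)) s := by
  have h1 : HasFDerivAt (Function.uncurry f) (fderiv ℝ (Function.uncurry f) (t, s)) (t, s) :=
    ((hf.differentiable (by simp)) (t, s)).hasFDerivAt
  have h2 : HasDerivAt (fun σ : ℝ => (t, σ)) ((0 : ℝ), (1 : ℝ)) s :=
    (hasDerivAt_const s t).prodMk (hasDerivAt_id s)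
  exact h1.comp_hasDerivAt s h2

lemma aux_mixed (f : ℝ → ℝ → ℝ) (hf : ContDiff ℝ (⊤ : ℕ∞) (Function.uncurry f)) (t s : ℝ) :
    HasDerivAt (fun σ => pτ f t σ) (pτ (ps f) t s) s ∧
    HasDerivAt (fun τ => ps f τ s) (pτ (ps f) t s) t := by
  have e1 : pτ f = fun t s => fderiv ℝ (Function.uncurry f) (t, s) (1, 0) := by
    funext t s; exact (aux_pτ f hf t s).deriv
  have e2 : ps f = fun t s => fderiv ℝ (Function.uncurry f) (t, s) (0, 1) := by
    funext t s; exact (aux_ps f hf t s).deriv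
  have hd : ContDiff ℝ (⊤ : ℕ∞) (fderiv ℝ (Function.uncurry f)) :=
    hf.fderiv_right (by simp)
  have h1 : HasFDerivAt (fderiv ℝ (Function.uncurry f))
      (fderiv ℝ (fderiv ℝ (Function.uncurry f)) (t, s)) (t, s) :=
    ((hd.differentiable (by simp)) (t, s)).hasFDerivAt
  have hsymm : IsSymmSndFDerivAt ℝ (Function.uncurry f) (t, s) :=
    hf.contDiffAt.isSymmSndFDerivAt (by
      rw [minSmoothness_of_isRCLikeNormedField]
      exact WithTop.coe_le_coe.2 (le_top : (2 : ℕ∞) ≤ ⊤))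
  have h2 : HasDerivAt (fun τ : ℝ => (τ, s)) ((1 : ℝ), (0 : ℝ)) t :=
    (hasDerivAt_id t).prodMk (hasDerivAt_const t s)
  have h3 : HasDerivAt (fun σ : ℝ => (t, σ)) ((0 : ℝ), (1 : ℝ)) s :=
    (hasDerivAt_const s t).prodMk (hasDerivAt_id s)
  have k4 : HasDerivAt (fun τ => ps f τ s) 
    (fderiv ℝ (fderiv ℝ (Function.uncurry f)) (t, s) (1, 0) (0, 1)) t := by
    rw [e2]
    exact (ContinuousLinearMap.apply ℝ ℝ ((0 : ℝ), (1 : ℝ))).hasFDerivAt.comp_hasDerivAt t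
      (h1.comp_hasDerivAt t h2)
  have k5 : HasDerivAt (fun σ => pτ f t σ) 
    (fderiv ℝ (fderiv ℝ (Function.uncurry f)) (t, s) (0, 1) (1, 0)) s := by
    rw [e1]
    exact (ContinuousLinearMap.apply ℝ ℝ ((1 : ℝ), (0 : ℝ))).hasFDerivAt.comp_hasDerivAt s
      (h1.comp_hasDerivAt s h3)
  have e : pτ (ps f) t s = _ := k4.deriv
  rw [e]
  exact ⟨by rw [hsymm.eq (1, 0) (0, 1)]; exact k5, k4⟩

lemma aux_eq (f g d : ℝ → ℝ) (hf : ∀ s, HasDerivAt f (d s) s) (hg : ∀ s, HasDerivAt g (d s) s)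
    (h0 : f 0 = g 0) (s : ℝ) : f s = g s := by
  have h : ∀ s, HasDerivAt (fun s => f s - g s) 0 s := fun s => by
    simpa using (hf s).fun_sub (hg s)
  have := is_const_of_deriv_eq_zero (fun s => (h s).differentiableAt) (fun s => (h s).deriv) s 0
  linarith

/-- For a smooth solution `θ` of the sine-Gordon equation `θ_{τs} = sin θ` and `(x,u)`
obtained by the hodograph transformation with base point satisfying
`x_τ(τ,0) = −(θ_τ(τ,0))²/2` and `u(τ,0) = θ_τ(τ,0)`, one has
`x_τ(τ,s) = −(θ_τ(τ,s))²/2` and `u(τ,s) = θ_τ(τ,s)` everywhere. -/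
theorem sineGordon_hodograph_identities
    (θ x u : ℝ → ℝ → ℝ)
    (hθ : ContDiff ℝ (⊤ : ℕ∞) (Function.uncurry θ))
    (hx : ContDiff ℝ (⊤ : ℕ∞) (Function.uncurry x))
    (hu : ContDiff ℝ (⊤ : ℕ∞) (Function.uncurry u))
    (hsg : ∀ τ ≥ (0:ℝ), ∀ s : ℝ, pτ (ps θ) τ s = Real.sin (θ τ s))
    (hhx : ∀ τ ≥ (0:ℝ), ∀ s : ℝ,
      x τ s = x τ 0 + ∫ σ in (0:ℝ)..s, Real.cos (θ τ σ))
    (hhu : ∀ τ ≥ (0:ℝ), ∀ s : ℝ,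
      u τ s = u τ 0 + ∫ σ in (0:ℝ)..s, Real.sin (θ τ σ))
    (hbase₁ : ∀ τ ≥ (0:ℝ), pτ x τ 0 = -(pτ θ τ 0)^2 / 2)
    (hbase₂ : ∀ τ ≥ (0:ℝ), u τ 0 = pτ θ τ 0) :
    ∀ τ ≥ (0:ℝ), ∀ s : ℝ,
      pτ x τ s = -(pτ θ τ s)^2 / 2 ∧ u τ s = pτ θ τ s := by
  intro τ hτ s
  have hθc : ∀ t, Continuous (fun σ => θ t σ) := fun t =>
    hθ.continuous.comp (by fun_prop : Continuous fun σ : ℝ => (t, σ))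
  have hθs : ∀ s, HasDerivAt (fun σ => pτ θ τ σ) (Real.sin (θ τ s)) s := fun s => by
    rw [← hsg τ hτ s]; exact (aux_mixed θ hθ τ s).1
  constructor
  · refine aux_eq (fun s => pτ x τ s) (fun s => -(pτ θ τ s)^2 / 2)
      (fun s => -Real.sin (θ τ s) * pτ θ τ s) ?_ ?_ (hbase₁ τ hτ) s
    · intro s
      have hps : ∀ t ≥ (0:ℝ), ps x t s = Real.cos (θ t s) := by
        intro t ht
        have hc : Continuous fun σ => Real.cos (θ t σ) := Real.continuous_cos.comp (hθc t)
        have h1 : (fun σ => x t σ) = fun s => x t 0 + ∫ σ in (0:ℝ)..s, Real.cos (θ t σ) :=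
          funext (hhx t ht)
        unfold ps
        rw [h1]
        exact ((hc.integral_hasStrictDerivAt 0 s).hasDerivAt.const_add _).deriv
      obtain ⟨m1, m2⟩ := aux_mixed x hx τ s
      have hc : HasDerivAt (fun t => Real.cos (θ t s)) (-Real.sin (θ τ s) * pτ θ τ s) τ := by
        have := (aux_pτ θ hθ τ s).differentiableAt.hasDerivAt
        exact this.cos
      have hw : HasDerivWithinAt (fun t => ps x t s) (-Real.sin (θ τ s) * pτ θ τ s)
          (Set.Ici τ) τ :=
        hc.hasDerivWithinAt.congr (fun t ht => hps t (le_trans hτ ht)) (hps τ hτ)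
      have e := (uniqueDiffOn_Ici τ τ Set.self_mem_Ici).eq_deriv _ m2.hasDerivWithinAt hw
      rw [← e]; exact m1
    · intro s
      have h := (((hθs s).fun_pow 2).fun_neg).div_const 2
      have e : -Real.sin (θ τ s) * pτ θ τ s = -(((2 : ℕ) : ℝ) * pτ θ τ s ^ (2 - 1) * Real.sin (θ τ s)) / 2 := by
        norm_num; ring
      rw [e]; exact h
  · refine aux_eq (fun s => u τ s) (fun s => pτ θ τ s)
      (fun s => Real.sin (θ τ s)) ?_ hθs (hbase₂ τ hτ) s
    intro s
    have hc : Continuous fun σ => Real.sin (θ τ σ) := Real.continuous_sin.comp (hθc τ)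
    have h1 : (fun σ => u τ σ) = fun s => u τ 0 + ∫ σ in (0:ℝ)..s, Real.sin (θ τ σ) :=
      funext (hhu τ hτ)
    rw [h1]
    exact (hc.integral_hasStrictDerivAt 0 s).hasDerivAt.const_add _
end

section
/- Let x, u : ℝ≥0 × ℝ → ℝ be a smooth solution of the parametrized form of the short pulse equation x_s(u_{τs} x_s − x_{τs} u_s) = u·x_s·(x_s² + u_s²) + (x_τ + u²/2)(u_{ss} x_s − x_{ss} u_s), satisfying x_τ(τ,s) + (u(τ,s))²/2 = 0 everywhere and x_s(τ,s) ≠ 0 for all τ ≥ 0 and s ∈ ℝ. Then (∂/∂τ)( (x_s(τ,s))² + (u_s(τ,s))² ) = 0 for all τ and s; in particular, if (x_s(0,s))² + (u_s(0,s))² = 1 for all s, then s is the arc-length parameter for every time τ. -/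
open Real

lemma ps_eq (f : ℝ → ℝ → ℝ) (hf : Differentiable ℝ (Function.uncurry f)) (t s : ℝ) :
    ps f t s = fderiv ℝ (Function.uncurry f) (t, s) (0, 1) := by
  have h1 : HasDerivAt (fun σ : ℝ => (t, σ)) ((0 : ℝ), (1 : ℝ)) s :=
    (hasDerivAt_const s t).prodMk (hasDerivAt_id s)
  exact ((hf (t, s)).hasFDerivAt.comp_hasDerivAt s h1).deriv

lemma pτ_eq (f : ℝ → ℝ → ℝ) (hf : Differentiable ℝ (Function.uncurry f)) (t s : ℝ) :
    pτ f t s = fderiv ℝ (Function.uncurry f) (t, s) (1, 0) := by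
  have h1 : HasDerivAt (fun σ : ℝ => (σ, s)) ((1 : ℝ), (0 : ℝ)) t :=
    (hasDerivAt_id t).prodMk (hasDerivAt_const t s)
  exact ((hf (t, s)).hasFDerivAt.comp_hasDerivAt t h1).deriv

lemma two_le_smooth : (2 : WithTop ℕ∞) ≤ ((⊤ : ℕ∞) : WithTop ℕ∞) :=
  WithTop.coe_le_coe.2 (le_top : (2 : ℕ∞) ≤ ⊤)

lemma diff_fderiv (f : ℝ → ℝ → ℝ) (hf : ContDiff ℝ (⊤ : ℕ∞) (Function.uncurry f)) :
    Differentiable ℝ (fderiv ℝ (Function.uncurry f)) :=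
  ((hf.of_le two_le_smooth).fderiv_right
    (m := 1) (by norm_num)).differentiable (by norm_num)

lemma uncurry_ps (f : ℝ → ℝ → ℝ) (hf : ContDiff ℝ (⊤ : ℕ∞) (Function.uncurry f)) :
    Function.uncurry (ps f) = fun p => fderiv ℝ (Function.uncurry f) p (0, 1) := by
  funext ⟨t, s⟩
  exact ps_eq f (hf.differentiable (by simp)) t s

lemma uncurry_pτ (f : ℝ → ℝ → ℝ) (hf : ContDiff ℝ (⊤ : ℕ∞) (Function.uncurry f)) :
    Function.uncurry (pτ f) = fun p => fderiv ℝ (Function.uncurry f) p (1, 0) := by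
  funext ⟨t, s⟩
  exact pτ_eq f (hf.differentiable (by simp)) t s

lemma diff_ps (f : ℝ → ℝ → ℝ) (hf : ContDiff ℝ (⊤ : ℕ∞) (Function.uncurry f)) :
    Differentiable ℝ (Function.uncurry (ps f)) := by
  rw [uncurry_ps f hf]
  exact (diff_fderiv f hf).clm_apply (differentiable_const _)

lemma diff_pτ (f : ℝ → ℝ → ℝ) (hf : ContDiff ℝ (⊤ : ℕ∞) (Function.uncurry f)) :
    Differentiable ℝ (Function.uncurry (pτ f)) := by
  rw [uncurry_pτ f hf]
  exact (diff_fderiv f hf).clm_apply (differentiable_const _)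

lemma fderiv_app (f : ℝ → ℝ → ℝ) (hf : ContDiff ℝ (⊤ : ℕ∞) (Function.uncurry f))
    (p v w : ℝ × ℝ) :
    fderiv ℝ (fun p => fderiv ℝ (Function.uncurry f) p v) p w
      = fderiv ℝ (fderiv ℝ (Function.uncurry f)) p w v := by
  rw [fderiv_clm_apply (diff_fderiv f hf p) (differentiableAt_const _)]
  simp

lemma mixed (f : ℝ → ℝ → ℝ) (hf : ContDiff ℝ (⊤ : ℕ∞) (Function.uncurry f)) (t s : ℝ) :
    pτ (ps f) t s = ps (pτ f) t s := by
  rw [pτ_eq _ (diff_ps f hf), ps_eq _ (diff_pτ f hf), uncurry_ps f hf, uncurry_pτ f hf,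
    fderiv_app f hf, fderiv_app f hf]
  have h : IsSymmSndFDerivAt ℝ (Function.uncurry f) (t, s) :=
    hf.contDiffAt.isSymmSndFDerivAt (by simpa using two_le_smooth)
  exact h.eq _ _

lemma hasDeriv_ps (f : ℝ → ℝ → ℝ) (hf : ContDiff ℝ (⊤ : ℕ∞) (Function.uncurry f)) (t s : ℝ) :
    HasDerivAt (fun τ => ps f τ s) (pτ (ps f) t s) t := by
  have h1 : DifferentiableAt ℝ (fun σ : ℝ => (σ, s)) t := by fun_prop
  exact (DifferentiableAt.comp t (diff_ps f hf (t, s)) h1).hasDerivAt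

/-- For a smooth solution `(x,u)` of the parametrized short pulse equation satisfying
`x_τ + u²/2 = 0` and `x_s ≠ 0` everywhere, the quantity `x_s² + u_s²` is time-independent:
its `τ`-derivative vanishes; in particular if `x_s² + u_s² = 1` at `τ = 0`, then `s` remains
an arc-length parameter for all times. -/
theorem paramSPE_arclength_preserved
    (x u : ℝ → ℝ → ℝ)
    (hx : ContDiff ℝ (⊤ : ℕ∞) (Function.uncurry x))
    (hu : ContDiff ℝ (⊤ : ℕ∞) (Function.uncurry u))
    (hspe : ∀ τ ≥ (0:ℝ), ∀ s : ℝ, ParamSPE x u τ s)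
    (hconstr : ∀ τ ≥ (0:ℝ), ∀ s : ℝ, pτ x τ s + (u τ s)^2 / 2 = 0)
    (hxs : ∀ τ ≥ (0:ℝ), ∀ s : ℝ, ps x τ s ≠ 0) :
    (∀ τ ≥ (0:ℝ), ∀ s : ℝ,
        pτ (fun t σ => (ps x t σ)^2 + (ps u t σ)^2) τ s = 0)
      ∧ ((∀ s : ℝ, (ps x 0 s)^2 + (ps u 0 s)^2 = 1) →
          ∀ τ ≥ (0:ℝ), ∀ s : ℝ, (ps x τ s)^2 + (ps u τ s)^2 = 1) := by
  have key : ∀ τ ≥ (0:ℝ), ∀ s : ℝ,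
      HasDerivAt (fun t => (ps x t s)^2 + (ps u t s)^2) 0 τ := by
    intro τ hτ s
    have hxt : pτ (ps x) τ s = - (u τ s * ps u τ s) := by
      rw [mixed x hx]
      have he : (fun σ => pτ x τ σ) = fun σ => - ((u τ σ)^2 / 2) := by
        funext σ
        linarith [hconstr τ hτ σ]
      have hd : HasDerivAt (fun σ => u τ σ) (ps u τ s) s := by
        have h1 : DifferentiableAt ℝ (fun σ : ℝ => (τ, σ)) s := by fun_prop
        exact (DifferentiableAt.comp s (hu.differentiable (by simp) (τ, s)) h1).hasDerivAt
      change deriv (fun σ => pτ x τ σ) s = _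
      rw [he]
      refine (((hd.pow 2).div_const 2).neg).deriv.trans ?_
      simp
      ring
    have h := hspe τ hτ s
    unfold ParamSPE at h
    rw [hconstr τ hτ s, hxt] at h
    have hne := hxs τ hτ s
    have hut : pτ (ps u) τ s = u τ s * ps x τ s := by
      apply mul_left_cancel₀ (pow_ne_zero 2 hne)
      linear_combination h
    have hD := ((hasDeriv_ps x hx τ s).pow 2).add ((hasDeriv_ps u hu τ s).pow 2)
    rw [hxt, hut] at hD
    refine HasDerivAt.congr_deriv (f := fun t => (ps x t s)^2 + (ps u t s)^2) hD ?_
    simp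
    ring
  refine ⟨fun τ hτ s => (key τ hτ s).deriv, fun h0 τ hτ s => ?_⟩
  have hc := constant_of_has_deriv_right_zero (a := 0) (b := τ)
    (f := fun t => (ps x t s)^2 + (ps u t s)^2)
    (fun t ht => (key t ht.1 s).continuousAt.continuousWithinAt)
    (fun t ht => (key t ht.1 s).hasDerivWithinAt) τ ⟨hτ, le_rfl⟩
  exact hc.trans (h0 s)
end

section
/- Let S > 0 and let θ : ℝ≥0 × [0,S] → ℝ be a smooth solution of the sine-Gordon equation θ_{τs} = sin θ satisfying (θ_τ(τ,S))² = (θ_τ(τ,0))² for every τ ≥ 0. Let x, u : ℝ≥0 × [0,S] → ℝ be obtained from θ via the hodograph transformation x(τ,s) = x(τ,0) + ∫₀ˢ cos θ(τ,σ) dσ, u(τ,s) = u(τ,0) + ∫₀ˢ sin θ(τ,σ) dσ. Then the window size L(τ) = x(τ,S) − x(τ,0) satisfies (d/dτ) L(τ) = 0 for every τ ≥ 0. -/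
open Real

lemma aux_l (F : ℝ × ℝ → ℝ) (hF : Differentiable ℝ F) (t s : ℝ) :
    HasDerivAt (fun τ => F (τ, s)) (fderiv ℝ F (t, s) (1, 0)) t := by
  have h := (hF (t, s)).hasFDerivAt
  exact h.comp_hasDerivAt (f := fun τ : ℝ => (τ, s)) t
    ((hasDerivAt_id t).prodMk (hasDerivAt_const t s))

lemma aux_r (F : ℝ × ℝ → ℝ) (hF : Differentiable ℝ F) (t s : ℝ) :
    HasDerivAt (fun σ => F (t, σ)) (fderiv ℝ F (t, s) (0, 1)) s := by
  have h := (hF (t, s)).hasFDerivAt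
  exact h.comp_hasDerivAt (f := fun σ : ℝ => (t, σ)) s
    ((hasDerivAt_const s t).prodMk (hasDerivAt_id s))

/-- For a smooth solution `θ` of the sine-Gordon equation `θ_{τs} = sin θ` on
`ℝ≥0 × [0,S]` with `(θ_τ(τ,S))² = (θ_τ(τ,0))²`, and `(x,u)` obtained from `θ` via the
hodograph transformation, the window size `L(τ) = x(τ,S) − x(τ,0)` is constant:
`(d/dτ) L(τ) = 0`. -/
theorem window_size_constant
    (S : ℝ) (hS : 0 < S) (θ x u : ℝ → ℝ → ℝ)
    (hθ : ContDiff ℝ (⊤ : ℕ∞) (Function.uncurry θ))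
    (hsg : ∀ τ ≥ (0:ℝ), ∀ s ∈ Set.Icc (0:ℝ) S, pτ (ps θ) τ s = Real.sin (θ τ s))
    (hbc : ∀ τ ≥ (0:ℝ), (pτ θ τ S)^2 = (pτ θ τ 0)^2)
    (hhx : ∀ τ ≥ (0:ℝ), ∀ s ∈ Set.Icc (0:ℝ) S,
      x τ s = x τ 0 + ∫ σ in (0:ℝ)..s, Real.cos (θ τ σ))
    (hhu : ∀ τ ≥ (0:ℝ), ∀ s ∈ Set.Icc (0:ℝ) S,
      u τ s = u τ 0 + ∫ σ in (0:ℝ)..s, Real.sin (θ τ σ)) :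
    ∀ τ ≥ (0:ℝ), deriv (fun t => x t S - x t 0) τ = 0 := by
  intro τ hτ
  set F := Function.uncurry θ with hFdef
  have hFd : Differentiable ℝ F := hθ.differentiable (by simp)
  have hF' : ContDiff ℝ (⊤ : ℕ∞) (fderiv ℝ F) := hθ.fderiv_right (by simp)
  have hA : ContDiff ℝ (⊤ : ℕ∞) (fun p => fderiv ℝ F p (1, 0)) := hF'.clm_apply contDiff_const
  have hB : ContDiff ℝ (⊤ : ℕ∞) (fun p => fderiv ℝ F p (0, 1)) := hF'.clm_apply contDiff_const
  have hF'd : Differentiable ℝ (fderiv ℝ F) := hF'.differentiable (by simp)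
  have hpτ : ∀ t s, pτ θ t s = fderiv ℝ F (t, s) (1, 0) := fun t s => (aux_l F hFd t s).deriv
  have hps : ∀ t s, ps θ t s = fderiv ℝ F (t, s) (0, 1) := fun t s => (aux_r F hFd t s).deriv
  have hmix : ∀ s ∈ Set.Icc (0:ℝ) S,
      HasDerivAt (fun σ => fderiv ℝ F (τ, σ) (1, 0)) (Real.sin (θ τ s)) s := by
    intro s hs
    have h1 := aux_r _ (hA.differentiable (by simp)) τ s
    have h2 := (aux_l _ (hB.differentiable (by simp)) τ s).deriv
    have h3 := hsg τ hτ s hs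
    have h4 : pτ (ps θ) τ s = deriv (fun t => fderiv ℝ F (t, s) (0, 1)) τ := by
      unfold pτ
      simp only [hps]
    have hsym : IsSymmSndFDerivAt ℝ F (τ, s) :=
      hθ.contDiffAt.isSymmSndFDerivAt (by simpa using WithTop.coe_le_coe.2 (le_top : (2:ℕ∞) ≤ ⊤))
    have e : ∀ v w : ℝ × ℝ, fderiv ℝ (fun p => fderiv ℝ F p v) (τ, s) w
        = fderiv ℝ (fderiv ℝ F) (τ, s) w v := by
      intro v w
      rw [fderiv_clm_apply (hF'd _) (differentiableAt_const _)]
      simp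
    rw [e] at h1 h2
    rw [hsym (0,1) (1,0), ← h2, ← h4, h3] at h1
    exact h1
  have hder : HasDerivAt (fun t => ∫ σ in (0:ℝ)..S, Real.cos (θ t σ))
      (∫ σ in (0:ℝ)..S, -Real.sin (θ τ σ) * fderiv ℝ F (τ, σ) (1, 0)) τ := by
    have hθc : Continuous F := hθ.continuous
    have hAc : Continuous (fun p => fderiv ℝ F p (1, 0)) := hA.continuous
    have hGc : Continuous (fun p : ℝ × ℝ => -Real.sin (F p) * fderiv ℝ F p (1, 0)) := by fun_prop
    obtain ⟨C, hC⟩ := ((isCompact_closedBall τ 1).prod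
      (isCompact_Icc (a := (0:ℝ)) (b := S))).exists_bound_of_continuousOn hGc.continuousOn
    have hcc : ∀ t, Continuous (fun σ => Real.cos (θ t σ)) := fun t =>
      Real.continuous_cos.comp (hθc.comp (by fun_prop : Continuous fun σ : ℝ => (t, σ)))
    have hgc : ∀ t, Continuous (fun σ => -Real.sin (θ t σ) * fderiv ℝ F (t, σ) (1, 0)) := by
      intro t
      have h : Continuous (fun σ => -Real.sin (F (t, σ)) * fderiv ℝ F (t, σ) (1, 0)) :=
        hGc.comp' (by fun_prop : Continuous fun σ : ℝ => (t, σ))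
      exact h
    refine (intervalIntegral.hasDerivAt_integral_of_dominated_loc_of_deriv_le
      (F := fun t σ => Real.cos (θ t σ))
      (F' := fun t σ => -Real.sin (θ t σ) * fderiv ℝ F (t, σ) (1, 0)) (bound := fun _ => C)
      (Metric.closedBall_mem_nhds τ one_pos) ?_ ?_ ?_ ?_ ?_ ?_).2
    · exact Filter.Eventually.of_forall fun t => (hcc t).aestronglyMeasurable
    · exact (hcc τ).intervalIntegrable _ _
    · exact (hgc τ).aestronglyMeasurable
    · refine Filter.Eventually.of_forall fun σ hσ t ht => ?_
      rw [Set.uIoc_of_le hS.le] at hσ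
      exact hC (t, σ) ⟨ht, hσ.1.le, hσ.2⟩
    · exact intervalIntegrable_const
    · refine Filter.Eventually.of_forall fun σ hσ t ht => ?_
      exact (aux_l F hFd t σ).cos
  have hzero : (∫ σ in (0:ℝ)..S, -Real.sin (θ τ σ) * fderiv ℝ F (τ, σ) (1, 0)) = 0 := by
    have hGc : Continuous (fun p : ℝ × ℝ => -Real.sin (F p) * fderiv ℝ F p (1, 0)) := by
      have hθc : Continuous F := hθ.continuous
      have hAc : Continuous (fun p => fderiv ℝ F p (1, 0)) := hA.continuous
      fun_prop
    rw [intervalIntegral.integral_eq_sub_of_hasDerivAt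
      (f := fun σ => -(fderiv ℝ F (τ, σ) (1, 0))^2 / 2)]
    · have := hbc τ hτ
      rw [hpτ, hpτ] at this
      simp only [this, sub_self]
    · intro s hs
      rw [Set.uIcc_of_le hS.le] at hs
      have h5 := ((hmix s hs).fun_pow 2).fun_neg.div_const 2
      refine h5.congr_deriv ?_
      push_cast
      ring
    · have h : Continuous (fun σ => -Real.sin (F (τ, σ)) * fderiv ℝ F (τ, σ) (1, 0)) :=
        hGc.comp' (by fun_prop : Continuous fun σ : ℝ => (τ, σ))
      exact h.intervalIntegrable _ _
  rw [hzero] at hder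
  by_cases hd : DifferentiableAt ℝ (fun t => x t S - x t 0) τ
  · have h1 := hd.hasDerivAt.hasDerivWithinAt (s := Set.Ici τ)
    have h2 : HasDerivWithinAt (fun t => x t S - x t 0) 0 (Set.Ici τ) τ := by
      refine hder.hasDerivWithinAt.congr (fun t ht => ?_) ?_
      · rw [hhx t (le_trans hτ ht) S ⟨hS.le, le_rfl⟩]; ring
      · rw [hhx τ hτ S ⟨hS.le, le_rfl⟩]; ring
    exact (uniqueDiffWithinAt_Ici τ).eq_deriv _ h1 h2
  · exact deriv_zero_of_not_differentiableAt hd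
end

section
/- Let S > 0, n ∈ ℤ, and let θ : ℝ≥0 × ℝ → ℝ be a smooth solution of the sine-Gordon equation θ_{τs} = sin θ satisfying θ(τ, s+S) = θ(τ,s) + 2nπ for all τ ≥ 0 and s ∈ ℝ. Let x, u : ℝ≥0 × ℝ → ℝ be obtained from θ via the hodograph transformation x(τ,s) = x(τ,0) + ∫₀ˢ cos θ(τ,σ) dσ, u(τ,s) = u(τ,0) + ∫₀ˢ sin θ(τ,σ) dσ, with base point satisfying x_τ(τ,0) = −(θ_τ(τ,0))²/2 and u(τ,0) = θ_τ(τ,0). Then, with L := ∫₀ˢ cos θ(0,σ) dσ (integral over σ ∈ [0,S]), the periodic boundary condition x(τ, s+S) = x(τ,s) + L and u(τ, s+S) = u(τ,s) holds for all τ ≥ 0 and s ∈ ℝ. -/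
open Real

/-- Leibniz rule for continuous data. -/
theorem hpb_leibniz (F F' : ℝ → ℝ → ℝ) (S : ℝ)
    (hF : Continuous (Function.uncurry F)) (hF' : Continuous (Function.uncurry F'))
    (hd : ∀ t s, HasDerivAt (fun τ => F τ s) (F' t s) t) (t : ℝ) :
    HasDerivAt (fun τ => ∫ σ in (0:ℝ)..S, F τ σ) (∫ σ in (0:ℝ)..S, F' t σ) t := by
  have hc : ∀ t, Continuous (F t) := fun t => hF.comp (by fun_prop : Continuous fun s : ℝ => (t, s))
  have hc' : ∀ t, Continuous (F' t) := fun t =>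
    hF'.comp (by fun_prop : Continuous fun s : ℝ => (t, s))
  obtain ⟨C, hC⟩ := (IsCompact.prod (isCompact_closedBall t 1)
    (isCompact_uIcc (a := (0:ℝ)) (b := S))).exists_bound_of_continuousOn hF'.continuousOn
  refine (intervalIntegral.hasDerivAt_integral_of_dominated_loc_of_deriv_le
    (bound := fun _ => C) (F' := F') (Metric.closedBall_mem_nhds t one_pos) ?_ ?_ ?_ ?_ ?_ ?_).2
  · exact Filter.Eventually.of_forall fun τ => (hc τ).aestronglyMeasurable
  · exact (hc t).intervalIntegrable _ _
  · exact (hc' t).aestronglyMeasurable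
  · exact Filter.Eventually.of_forall fun σ hσ τ hτ =>
      hC (τ, σ) ⟨hτ, Set.uIoc_subset_uIcc hσ⟩
  · exact continuous_const.intervalIntegrable _ _
  · exact Filter.Eventually.of_forall fun σ hσ τ hτ => hd τ σ

/-- For a smooth solution `θ` of the sine-Gordon equation `θ_{τs} = sin θ` with
quasi-periodic boundary condition `θ(τ, s+S) = θ(τ,s) + 2nπ`, the curve `(x,u)` obtained
by the hodograph transformation with base point satisfying
`x_τ(τ,0) = −(θ_τ(τ,0))²/2`, `u(τ,0) = θ_τ(τ,0)` satisfies the periodic boundary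
condition `x(τ,s+S) = x(τ,s) + L`, `u(τ,s+S) = u(τ,s)` with
`L = ∫₀ˢ cos θ(0,σ) dσ`. -/
theorem hodograph_periodic_boundary
    (S : ℝ) (hS : 0 < S) (n : ℤ) (θ x u : ℝ → ℝ → ℝ)
    (hθ : ContDiff ℝ (⊤ : ℕ∞) (Function.uncurry θ))
    (hsg : ∀ τ ≥ (0:ℝ), ∀ s : ℝ, pτ (ps θ) τ s = Real.sin (θ τ s))
    (hper : ∀ τ ≥ (0:ℝ), ∀ s : ℝ, θ τ (s + S) = θ τ s + 2 * (n : ℝ) * Real.pi)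
    (hhx : ∀ τ ≥ (0:ℝ), ∀ s : ℝ,
      x τ s = x τ 0 + ∫ σ in (0:ℝ)..s, Real.cos (θ τ σ))
    (hhu : ∀ τ ≥ (0:ℝ), ∀ s : ℝ,
      u τ s = u τ 0 + ∫ σ in (0:ℝ)..s, Real.sin (θ τ σ))
    (hbase₁ : ∀ τ ≥ (0:ℝ), pτ x τ 0 = -(pτ θ τ 0)^2 / 2)
    (hbase₂ : ∀ τ ≥ (0:ℝ), u τ 0 = pτ θ τ 0)
    (L : ℝ) (hL : L = ∫ σ in (0:ℝ)..S, Real.cos (θ 0 σ)) :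
    ∀ τ ≥ (0:ℝ), ∀ s : ℝ,
      x τ (s + S) = x τ s + L ∧ u τ (s + S) = u τ s := by
  set f := Function.uncurry θ with hf
  have hdf : Differentiable ℝ f := hθ.differentiable (by simp)
  have hD : ContDiff ℝ 1 (fderiv ℝ f) := hθ.fderiv_right (m := 1) (by norm_cast)
  have hdD : Differentiable ℝ (fderiv ℝ f) := hD.differentiable (by simp)
  have l1 : ∀ t s : ℝ, HasDerivAt (fun τ : ℝ => (τ, s)) ((1:ℝ), (0:ℝ)) t := fun t s =>
    (hasDerivAt_id t).prodMk (hasDerivAt_const t s)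
  have l2 : ∀ t s : ℝ, HasDerivAt (fun σ : ℝ => (t, σ)) ((0:ℝ), (1:ℝ)) s := fun t s =>
    (hasDerivAt_const s t).prodMk (hasDerivAt_id s)
  have h1 : ∀ t s, HasDerivAt (fun τ => θ τ s) (fderiv ℝ f (t, s) (1, 0)) t := fun t s =>
    HasFDerivAt.comp_hasDerivAt (f := fun τ : ℝ => (τ, s)) t (hdf (t, s)).hasFDerivAt (l1 t s)
  have h2 : ∀ t s, HasDerivAt (fun σ => θ t σ) (fderiv ℝ f (t, s) (0, 1)) s := fun t s =>
    HasFDerivAt.comp_hasDerivAt (f := fun σ : ℝ => (t, σ)) s (hdf (t, s)).hasFDerivAt (l2 t s)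
  set v : ℝ → ℝ → ℝ := fun t s => fderiv ℝ f (t, s) (1, 0) with hv
  have hvc : Continuous (Function.uncurry v) := by
    have : Continuous fun p : ℝ × ℝ => fderiv ℝ f p (1, 0) := hD.continuous.clm_apply continuous_const
    exact this
  have hps : ps θ = fun t s => fderiv ℝ f (t, s) (0, 1) := by
    funext t s
    exact (h2 t s).deriv
  -- derivative of `v` in `s`
  have hvs : ∀ t ≥ (0:ℝ), ∀ s, HasDerivAt (fun σ => v t σ) (Real.sin (θ t s)) s := by
    intro t ht s
    have a1 : HasDerivAt (fun σ => fderiv ℝ f (t, σ))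
        (fderiv ℝ (fderiv ℝ f) (t, s) (0, 1)) s :=
      HasFDerivAt.comp_hasDerivAt (f := fun σ : ℝ => (t, σ)) s (hdD (t, s)).hasFDerivAt (l2 t s)
    have a2 : HasDerivAt (fun τ => fderiv ℝ f (τ, s))
        (fderiv ℝ (fderiv ℝ f) (t, s) (1, 0)) t :=
      HasFDerivAt.comp_hasDerivAt (f := fun τ : ℝ => (τ, s)) t (hdD (t, s)).hasFDerivAt (l1 t s)
    have b1 := a1.clm_apply (hasDerivAt_const s ((1:ℝ), (0:ℝ)))
    have b2 := a2.clm_apply (hasDerivAt_const t ((0:ℝ), (1:ℝ)))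
    have hs := hsg t ht s
    rw [hps] at hs
    have hs2 := b2.deriv
    simp only [pτ] at hs
    rw [hs] at hs2
    have sym := second_derivative_symmetric (fun y => (hdf y).hasFDerivAt)
      (hdD (t, s)).hasFDerivAt ((1:ℝ), (0:ℝ)) ((0:ℝ), (1:ℝ))
    rw [hs2, sym]
    exact b1
  have hvper : ∀ t ≥ (0:ℝ), ∀ s, v t (s + S) = v t s := by
    intro t ht s
    have c1 := (h1 t (s + S)).hasDerivWithinAt (s := Set.Ici t)
    have c2 := ((h1 t s).add_const (2 * (n : ℝ) * Real.pi)).hasDerivWithinAt (s := Set.Ici t)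
    have c3 := c2.congr (fun τ hτ => hper τ (ge_trans hτ ht) s) (hper t ht s)
    exact (uniqueDiffWithinAt_Ici t).eq_deriv _ c1 c3
  have hct : ∀ t, Continuous (θ t) := fun t =>
    hθ.continuous.comp (by fun_prop : Continuous fun s : ℝ => (t, s))
  have hcos : ∀ t, Continuous fun s => Real.cos (θ t s) := fun t => Real.continuous_cos.comp (hct t)
  have hsin : ∀ t, Continuous fun s => Real.sin (θ t s) := fun t => Real.continuous_sin.comp (hct t)
  have hconst : ∀ t ≥ (0:ℝ), ∫ σ in (0:ℝ)..S, Real.cos (θ t σ) = L := by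
    intro t ht
    have hder := hpb_leibniz (fun τ σ => Real.cos (θ τ σ)) (fun τ σ => -Real.sin (θ τ σ) * v τ σ) S
      (Real.continuous_cos.comp hθ.continuous)
      ((Real.continuous_sin.comp hθ.continuous).neg.mul hvc)
      (fun t s => (h1 t s).cos)
    rw [hL]
    refine constant_of_has_deriv_right_zero (a := 0) (b := t)
      (f := fun τ => ∫ σ in (0:ℝ)..S, Real.cos (θ τ σ))
      (fun τ _ => (hder τ).continuousAt.continuousWithinAt) ?_ t ⟨ht, le_rfl⟩
    intro τ hτ
    have e : ∫ σ in (0:ℝ)..S, -Real.sin (θ τ σ) * v τ σ = 0 := by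
      have hcv : Continuous (v τ) := hvc.comp (by fun_prop : Continuous fun s : ℝ => (τ, s))
      have k := intervalIntegral.integral_eq_sub_of_hasDerivAt (a := 0) (b := S)
        (f := fun σ => -(v τ σ) ^ 2 / 2) (f' := fun σ => -Real.sin (θ τ σ) * v τ σ)
        (fun σ _ => by
          have d := ((hvs τ hτ.1 σ).pow 2).neg.div_const 2
          have d2 : -Real.sin (θ τ σ) * v τ σ
              = -(((2:ℕ):ℝ) * v τ σ ^ (2 - 1) * Real.sin (θ τ σ)) / 2 := by
            norm_num; ring
          rw [d2]
          exact d)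
        (((hsin τ).neg.mul hcv).intervalIntegrable _ _)
      rw [k]
      have := hvper τ hτ.1 0
      rw [zero_add] at this
      simp [this]
    have := (hder τ).hasDerivWithinAt (s := Set.Ici τ)
    rwa [e] at this
  intro t ht s
  constructor
  · rw [hhx t ht (s + S), hhx t ht s, ← hconst t ht]
    have hp : Function.Periodic (fun σ => Real.cos (θ t σ)) S := by
      intro σ
      simp only [hper t ht σ]
      rw [show 2 * (n : ℝ) * Real.pi = n * (2 * Real.pi) by ring, Real.cos_add_int_mul_two_pi]
    have k := hp.intervalIntegral_add_eq s 0
    rw [zero_add] at k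
    rw [← k, add_assoc, intervalIntegral.integral_add_adjacent_intervals
      ((hcos t).intervalIntegrable _ _) ((hcos t).intervalIntegrable _ _)]
  · rw [hhu t ht (s + S), hhu t ht s,
      intervalIntegral.integral_eq_sub_of_hasDerivAt (fun σ _ => hvs t ht σ)
        ((hsin t).intervalIntegrable _ _),
      intervalIntegral.integral_eq_sub_of_hasDerivAt (fun σ _ => hvs t ht σ)
        ((hsin t).intervalIntegrable _ _), hvper t ht s]
end

section
/- Let S > 0, n ∈ ℤ, and let θ : ℝ≥0 × ℝ → ℝ be a smooth solution of the sine-Gordon equation θ_{τs} = sin θ satisfying θ(τ, s+S) = θ(τ,s) + 2nπ for all τ ≥ 0 and s ∈ ℝ. Let x, u be obtained from θ via the hodograph transformation x(τ,s) = x(τ,0) + ∫₀ˢ cos θ(τ,σ) dσ, u(τ,s) = u(τ,0) + ∫₀ˢ sin θ(τ,σ) dσ, with base point satisfying u(τ,0) = θ_τ(τ,0). Then the implicit constraint ∫₀ˢ u(τ,s)·x_s(τ,s) ds = 0 holds (integral over s ∈ [0,S]) for every τ ≥ 0; that is, ∫₀ˢ u(τ,s)·cos θ(τ,s) ds = 0.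 -/
open Real

lemma aux_t {f : ℝ → ℝ → ℝ} (hf : ContDiff ℝ (⊤ : ℕ∞) (Function.uncurry f)) (t s : ℝ) :
    HasDerivAt (fun τ => f τ s) (fderiv ℝ (Function.uncurry f) (t, s) (1, 0)) t := by
  have h := (hf.differentiable (by simp) (t, s)).hasFDerivAt
  have h2 : HasDerivAt (fun τ : ℝ => (τ, s)) ((1 : ℝ), (0 : ℝ)) t :=
    (hasDerivAt_id t).prodMk (hasDerivAt_const t s)
  exact h.comp_hasDerivAt t h2

lemma aux_s {f : ℝ → ℝ → ℝ} (hf : ContDiff ℝ (⊤ : ℕ∞) (Function.uncurry f)) (t s : ℝ) :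
    HasDerivAt (fun σ => f t σ) (fderiv ℝ (Function.uncurry f) (t, s) (0, 1)) s := by
  have h := (hf.differentiable (by simp) (t, s)).hasFDerivAt
  have h2 : HasDerivAt (fun σ : ℝ => (t, σ)) ((0 : ℝ), (1 : ℝ)) s :=
    (hasDerivAt_const s t).prodMk (hasDerivAt_id s)
  exact h.comp_hasDerivAt s h2

lemma unc_t {f : ℝ → ℝ → ℝ} (hf : ContDiff ℝ (⊤ : ℕ∞) (Function.uncurry f)) :
    Function.uncurry (pτ f) = fun p => fderiv ℝ (Function.uncurry f) p (1, 0) := by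
  funext ⟨t, s⟩
  exact (aux_t hf t s).deriv

lemma unc_s {f : ℝ → ℝ → ℝ} (hf : ContDiff ℝ (⊤ : ℕ∞) (Function.uncurry f)) :
    Function.uncurry (ps f) = fun p => fderiv ℝ (Function.uncurry f) p (0, 1) := by
  funext ⟨t, s⟩
  exact (aux_s hf t s).deriv

lemma smooth_t {f : ℝ → ℝ → ℝ} (hf : ContDiff ℝ (⊤ : ℕ∞) (Function.uncurry f)) :
    ContDiff ℝ (⊤ : ℕ∞) (Function.uncurry (pτ f)) := by
  rw [unc_t hf]
  exact (hf.fderiv_right (m := (⊤ : ℕ∞)) (by simp)).clm_apply contDiff_const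

lemma smooth_s {f : ℝ → ℝ → ℝ} (hf : ContDiff ℝ (⊤ : ℕ∞) (Function.uncurry f)) :
    ContDiff ℝ (⊤ : ℕ∞) (Function.uncurry (ps f)) := by
  rw [unc_s hf]
  exact (hf.fderiv_right (m := (⊤ : ℕ∞)) (by simp)).clm_apply contDiff_const

lemma has_t {f : ℝ → ℝ → ℝ} (hf : ContDiff ℝ (⊤ : ℕ∞) (Function.uncurry f)) (t s : ℝ) :
    HasDerivAt (fun τ => f τ s) (pτ f t s) t := (aux_t hf t s).differentiableAt.hasDerivAt

lemma has_s {f : ℝ → ℝ → ℝ} (hf : ContDiff ℝ (⊤ : ℕ∞) (Function.uncurry f)) (t s : ℝ) :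
    HasDerivAt (fun σ => f t σ) (ps f t s) s := (aux_s hf t s).differentiableAt.hasDerivAt

lemma comm_ts {f : ℝ → ℝ → ℝ} (hf : ContDiff ℝ (⊤ : ℕ∞) (Function.uncurry f)) (t s : ℝ) :
    ps (pτ f) t s = pτ (ps f) t s := by
  have h1 : ps (pτ f) t s = _ := (aux_s (smooth_t hf) t s).deriv
  have h2 : pτ (ps f) t s = _ := (aux_t (smooth_s hf) t s).deriv
  have hd : DifferentiableAt ℝ (fderiv ℝ (Function.uncurry f)) (t, s) :=
    (hf.fderiv_right (m := (⊤ : ℕ∞)) (by simp)).differentiable (by simp) _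
  rw [h1, h2, unc_t hf, unc_s hf, fderiv_clm_apply hd (by fun_prop),
    fderiv_clm_apply hd (by fun_prop)]
  have hsym : IsSymmSndFDerivAt ℝ (Function.uncurry f) (t, s) :=
    (hf.contDiffAt).isSymmSndFDerivAt (by simp; exact WithTop.coe_le_coe.2 (le_top (a := (2 : ℕ∞))))
  simpa using hsym (0, 1) (1, 0)

lemma deriv_unique {f g : ℝ → ℝ} {f' g' t : ℝ} (ht : 0 ≤ t) (hf : HasDerivAt f f' t)
    (hg : HasDerivAt g g' t) (h : ∀ r ≥ (0:ℝ), f r = g r) : f' = g' := by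
  have h1 : HasDerivWithinAt g f' (Set.Ici t) t :=
    hf.hasDerivWithinAt.congr (fun r hr => (h r (le_trans ht hr)).symm) (h t ht).symm
  exact (uniqueDiffWithinAt_Ici t).eq_deriv _ h1 hg.hasDerivWithinAt


/-- For a smooth solution `θ` of the sine-Gordon equation `θ_{τs} = sin θ` with
quasi-periodic boundary condition `θ(τ, s+S) = θ(τ,s) + 2nπ`, and `(x,u)` obtained by the
hodograph transformation with base point satisfying `u(τ,0) = θ_τ(τ,0)`, the implicit
constraint `∫₀ˢ u(τ,s)·x_s(τ,s) ds = 0` holds, i.e. `∫₀ˢ u(τ,s)·cos θ(τ,s) ds = 0`. -/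
theorem hodograph_implicit_constraint
    (S : ℝ) (hS : 0 < S) (n : ℤ) (θ x u : ℝ → ℝ → ℝ)
    (hθ : ContDiff ℝ (⊤ : ℕ∞) (Function.uncurry θ))
    (hsg : ∀ τ ≥ (0:ℝ), ∀ s : ℝ, pτ (ps θ) τ s = Real.sin (θ τ s))
    (hper : ∀ τ ≥ (0:ℝ), ∀ s : ℝ, θ τ (s + S) = θ τ s + 2 * (n : ℝ) * Real.pi)
    (hhx : ∀ τ ≥ (0:ℝ), ∀ s : ℝ,
      x τ s = x τ 0 + ∫ σ in (0:ℝ)..s, Real.cos (θ τ σ))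
    (hhu : ∀ τ ≥ (0:ℝ), ∀ s : ℝ,
      u τ s = u τ 0 + ∫ σ in (0:ℝ)..s, Real.sin (θ τ σ))
    (hbase : ∀ τ ≥ (0:ℝ), u τ 0 = pτ θ τ 0) :
    ∀ τ ≥ (0:ℝ), ∫ s in (0:ℝ)..S, u τ s * Real.cos (θ τ s) = 0 := by
  have hφ := smooth_t hθ
  have hφs : ∀ τ ≥ (0:ℝ), ∀ s, ps (pτ θ) τ s = Real.sin (θ τ s) := fun τ hτ s => by
    rw [comm_ts hθ, hsg τ hτ s]
  have cont_s : ∀ {f : ℝ → ℝ → ℝ}, ContDiff ℝ (⊤ : ℕ∞) (Function.uncurry f) →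
      ∀ t, Continuous (fun σ => f t σ) := fun hf t =>
    continuous_iff_continuousAt.2 fun s => (has_s hf t s).continuousAt
  have hu : ∀ τ ≥ (0:ℝ), ∀ s, u τ s = pτ θ τ s := by
    intro τ hτ s
    have h := intervalIntegral.integral_eq_sub_of_hasDerivAt (a := 0) (b := s)
      (fun r _ => has_s hφ τ r) ((cont_s (smooth_s hφ) τ).intervalIntegrable _ _)
    simp only [hφs τ hτ] at h
    rw [hhu τ hτ, hbase τ hτ, h]; ring
  have hφper : ∀ τ ≥ (0:ℝ), pτ θ τ S = pτ θ τ 0 := by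
    intro τ hτ
    refine deriv_unique hτ (has_t hθ τ S) ((has_t hθ τ 0).add_const (2 * (n : ℝ) * Real.pi)) ?_
    intro r hr
    simpa using hper r hr 0
  have hφφper : ∀ τ ≥ (0:ℝ), pτ (pτ θ) τ S = pτ (pτ θ) τ 0 := fun τ hτ =>
    deriv_unique hτ (has_t hφ τ S) (has_t hφ τ 0) hφper
  intro τ hτ
  have key : ∀ s, ps (pτ (pτ θ)) τ s = u τ s * Real.cos (θ τ s) := by
    intro s
    rw [comm_ts hφ, hu τ hτ, mul_comm]
    exact deriv_unique hτ (has_t (smooth_s hφ) τ s) (has_t hθ τ s).sin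
      (fun r hr => hφs r hr s)
  have h := intervalIntegral.integral_eq_sub_of_hasDerivAt (a := 0) (b := S)
      (fun r _ => has_s (smooth_t hφ) τ r)
      ((cont_s (smooth_s (smooth_t hφ)) τ).intervalIntegrable _ _)
  simp only [key] at h
  rw [h, hφφper τ hτ, sub_self]
end

section
/- Fix Δτ, Δs > 0, K ∈ ℕ with K ≥ 1, and let θ⁽ᵐ⁾, θ⁽ᵐ⁺¹⁾ : ℤ → ℝ satisfy θ⁽ᵐ⁺¹⁾ₖ ≠ θ⁽ᵐ⁾ₖ for all k, and let aₖ := −(cos θ⁽ᵐ⁺¹⁾ₖ − cos θ⁽ᵐ⁾ₖ)/(θ⁽ᵐ⁺¹⁾ₖ − θ⁽ᵐ⁾ₖ). Suppose the average-difference scheme ((θ⁽ᵐ⁺¹⁾ₖ₊₁ − θ⁽ᵐ⁺¹⁾ₖ) − (θ⁽ᵐ⁾ₖ₊₁ − θ⁽ᵐ⁾ₖ))/(Δs·Δτ) = (aₖ₊₁ + aₖ)/2 holds for k = 1,…,K, and the discrete boundary condition ((θ⁽ᵐ⁺¹⁾_{K+1} − θ⁽ᵐ⁾_{K+1})/Δτ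 − (Δs/2)·a_{K+1})² = ((θ⁽ᵐ⁺¹⁾₁ − θ⁽ᵐ⁾₁)/Δτ − (Δs/2)·a₁)² holds. Then H_d(θ⁽ᵐ⁺¹⁾) = H_d(θ⁽ᵐ⁾), where H_d(θ) = −Σ_{k=1}^{K} cos θₖ · Δs. -/
open Real

/-- Discrete conservation of the Hamiltonian `H_d(θ) = −Σ_{k=1}^K cos θₖ · Δs` for the
average-difference scheme for the sine-Gordon equation. -/
theorem average_difference_scheme_conserves_Hd
    (Δτ Δs : ℝ) (hΔτ : 0 < Δτ) (hΔs : 0 < Δs) (K : ℕ) (hK : 1 ≤ K)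
    (θ0 θ1 : ℤ → ℝ) (hne : ∀ k : ℤ, θ1 k ≠ θ0 k)
    (a : ℤ → ℝ)
    (ha : ∀ k : ℤ, a k = -(Real.cos (θ1 k) - Real.cos (θ0 k)) / (θ1 k - θ0 k))
    (hscheme : ∀ k : ℤ, 1 ≤ k → k ≤ (K : ℤ) →
      ((θ1 (k + 1) - θ1 k) - (θ0 (k + 1) - θ0 k)) / (Δs * Δτ) = (a (k + 1) + a k) / 2)
    (hbc : ((θ1 ((K : ℤ) + 1) - θ0 ((K : ℤ) + 1)) / Δτ - (Δs / 2) * a ((K : ℤ) + 1))^2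
         = ((θ1 1 - θ0 1) / Δτ - (Δs / 2) * a 1)^2) :
    (-∑ k ∈ Finset.Icc (1 : ℤ) (K : ℤ), Real.cos (θ1 k) * Δs)
      = -∑ k ∈ Finset.Icc (1 : ℤ) (K : ℤ), Real.cos (θ0 k) * Δs := by
  have hstep : ∀ k : ℤ, 1 ≤ k → k ≤ (K : ℤ) →
      Real.cos (θ1 k) * Δs - Real.cos (θ0 k) * Δs =
        -(Δτ / 2) * (((θ1 (k + 1) - θ0 (k + 1)) / Δτ - (Δs / 2) * a (k + 1)) ^ 2
          - ((θ1 k - θ0 k) / Δτ - (Δs / 2) * a k) ^ 2) := by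
    intro k h1 h2
    have hs := hscheme k h1 h2
    have hd : θ1 k - θ0 k ≠ 0 := sub_ne_zero.mpr (hne k)
    have hak : a k * (θ1 k - θ0 k) = -(Real.cos (θ1 k) - Real.cos (θ0 k)) := by
      rw [ha k]; field_simp
    have hw : (θ1 (k + 1) - θ0 (k + 1)) / Δτ - (Δs / 2) * a (k + 1)
        = (θ1 k - θ0 k) / Δτ + (Δs / 2) * a k := by
      rw [div_eq_iff (by positivity)] at hs
      have h3 : θ1 (k + 1) - θ0 (k + 1)
          = (θ1 k - θ0 k) + (a (k + 1) + a k) / 2 * (Δs * Δτ) := by linarith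
      rw [h3]; field_simp; ring
    rw [hw]
    have h4 : -(Δτ / 2) * (((θ1 k - θ0 k) / Δτ + (Δs / 2) * a k) ^ 2
          - ((θ1 k - θ0 k) / Δτ - (Δs / 2) * a k) ^ 2)
          = -Δs * (a k * (θ1 k - θ0 k)) := by
      field_simp; ring
    rw [h4, hak]; ring
  have hsum : ∀ n : ℕ, n ≤ K →
      ∑ k ∈ Finset.Icc (1 : ℤ) (n : ℤ), (Real.cos (θ1 k) * Δs - Real.cos (θ0 k) * Δs) =
        -(Δτ / 2) * (((θ1 ((n : ℤ) + 1) - θ0 ((n : ℤ) + 1)) / Δτ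
            - (Δs / 2) * a ((n : ℤ) + 1)) ^ 2
          - ((θ1 1 - θ0 1) / Δτ - (Δs / 2) * a 1) ^ 2) := by
    intro n
    induction n with
    | zero => intro _; simp
    | succ n ih =>
      intro hn
      have hI : Finset.Icc (1 : ℤ) ((n + 1 : ℕ) : ℤ)
          = insert ((n : ℤ) + 1) (Finset.Icc (1 : ℤ) (n : ℤ)) := by
        ext x
        simp only [Finset.mem_Icc, Finset.mem_insert]
        omega
      have hnot : ((n : ℤ) + 1) ∉ Finset.Icc (1 : ℤ) (n : ℤ) := by
        simp only [Finset.mem_Icc]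
        omega
      rw [hI, Finset.sum_insert hnot, ih (by omega), hstep _ (by omega) (by omega)]
      push_cast
      ring
  have h := hsum K le_rfl
  rw [hbc, sub_self, mul_zero, Finset.sum_sub_distrib] at h
  linarith
end

section
/- Fix Δτ, Δs > 0, K ≥ 1, n ∈ ℤ, and let θ⁽ᵐ⁾, θ⁽ᵐ⁺¹⁾ : ℤ → ℝ satisfy the quasi-periodicity θ⁽ʲ⁾_{k+K} = θ⁽ʲ⁾ₖ + 2nπ for j ∈ {m, m+1} and all k ∈ ℤ, satisfy θ⁽ᵐ⁺¹⁾ₖ ≠ θ⁽ᵐ⁾ₖ for all k, and solve the average-difference scheme ((θ⁽ᵐ⁺¹⁾ₖ₊₁ − θ⁽ᵐ⁺¹⁾ₖ) − (θ⁽ᵐ⁾ₖ₊₁ − θ⁽ᵐ⁾ₖ))/(Δs·Δτ) = (aₖ₊₁ + aₖ)/2 for all k ∈ ℤ, where aₖ = −(cos θ⁽ᵐ⁺¹⁾ₖ − cos θ⁽ᵐ⁾ₖ)/(θ⁽ᵐ⁺¹⁾ₖ − θ⁽ᵐ⁾ₖ). Define, from arbitrary x⁽ᵐ⁾₀, u⁽ᵐ⁾₀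 ∈ ℝ, the discrete hodograph transformation x⁽ᵐ⁾ₖ = x⁽ᵐ⁾₀ + Σ_{i=1}^{k} cos θ⁽ᵐ⁾ᵢ · Δs and u⁽ᵐ⁾ₖ = u⁽ᵐ⁾₀ + Σ_{i=1}^{k} ((aᵢ + aᵢ₋₁)/2) · Δs. Then x⁽ᵐ⁾_{k+K} = x⁽ᵐ⁾ₖ + L and u⁽ᵐ⁾_{k+K} = u⁽ᵐ⁾ₖ for all k ∈ ℤ, where L := Σ_{i=1}^{K} cos θ⁽ᵐ⁾ᵢ · Δs = −H_d(θ⁽ᵐ⁾). -/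
open Real

/-- For a quasi-periodic solution of the average-difference scheme for the sine-Gordon
equation, the curve obtained by the discrete hodograph transformation
(`xₖ − xₖ₋₁ = cos θ⁽ᵐ⁾ₖ · Δs`, `uₖ − uₖ₋₁ = ((aₖ + aₖ₋₁)/2) · Δs`, i.e.
`xₖ = x₀ + Σ_{i=1}^k cos θ⁽ᵐ⁾ᵢ·Δs`, `uₖ = u₀ + Σ_{i=1}^k ((aᵢ+aᵢ₋₁)/2)·Δs`)
satisfies the discrete periodic boundary condition `x_{k+K} = xₖ + L`, `u_{k+K} = uₖ`,
with `L = Σ_{i=1}^K cos θ⁽ᵐ⁾ᵢ · Δs = −H_d(θ⁽ᵐ⁾)`. -/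
theorem discrete_hodograph_periodic_boundary
    (Δτ Δs : ℝ) (hΔτ : 0 < Δτ) (hΔs : 0 < Δs) (K : ℕ) (hK : 1 ≤ K) (n : ℤ)
    (θ0 θ1 : ℤ → ℝ)
    (hper0 : ∀ k : ℤ, θ0 (k + (K : ℤ)) = θ0 k + 2 * (n : ℝ) * Real.pi)
    (hper1 : ∀ k : ℤ, θ1 (k + (K : ℤ)) = θ1 k + 2 * (n : ℝ) * Real.pi)
    (hne : ∀ k : ℤ, θ1 k ≠ θ0 k)
    (a : ℤ → ℝ)
    (ha : ∀ k : ℤ, a k = -(Real.cos (θ1 k) - Real.cos (θ0 k)) / (θ1 k - θ0 k))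
    (hscheme : ∀ k : ℤ,
      ((θ1 (k + 1) - θ1 k) - (θ0 (k + 1) - θ0 k)) / (Δs * Δτ) = (a (k + 1) + a k) / 2)
    (x u : ℤ → ℝ)
    (hx : ∀ k : ℤ, x k - x (k - 1) = Real.cos (θ0 k) * Δs)
    (hu : ∀ k : ℤ, u k - u (k - 1) = ((a k + a (k - 1)) / 2) * Δs)
    (L : ℝ) (hL : L = ∑ i ∈ Finset.Icc (1 : ℤ) (K : ℤ), Real.cos (θ0 i) * Δs) :
    ∀ k : ℤ, x (k + (K : ℤ)) = x k + L ∧ u (k + (K : ℤ)) = u k := by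
  have hconst : ∀ f : ℤ → ℝ, (∀ k, f k = f (k - 1)) → ∀ k, f k = f 0 := by
    intro f hf k
    induction k using Int.induction_on with
    | zero => rfl
    | succ i ih =>
      rw [hf, add_sub_cancel_right, ih]
    | pred i ih =>
      rw [← hf, ih]
  have hsum : ∀ N : ℕ, x N - x 0 = ∑ i ∈ Finset.Icc (1 : ℤ) (N : ℤ), Real.cos (θ0 i) * Δs := by
    intro N
    induction N with
    | zero => simp
    | succ N ih =>
      have h1 : Finset.Icc (1 : ℤ) ((N + 1 : ℕ) : ℤ)
          = insert ((N : ℤ) + 1) (Finset.Icc (1 : ℤ) (N : ℤ)) := by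
        ext j
        simp only [Finset.mem_Icc, Finset.mem_insert]
        omega
      have h2 : ((N : ℤ) + 1) ∉ Finset.Icc (1 : ℤ) (N : ℤ) := by
        simp only [Finset.mem_Icc]
        omega
      rw [h1, Finset.sum_insert h2, ← ih, ← hx, add_sub_cancel_right]
      push_cast
      ring
  intro k
  constructor
  · have h := hconst (fun k => x (k + (K : ℤ)) - x k) (by
      intro k
      have h1 := hx (k + K)
      have h2 := hx k
      have h3 : Real.cos (θ0 (k + K)) = Real.cos (θ0 k) := by
        rw [hper0, ← Real.cos_add_int_mul_two_pi (θ0 k) n]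
        congr 1
        ring
      rw [h3] at h1
      have h4 : k - 1 + (K : ℤ) = k + K - 1 := by ring
      simp only [h4]
      linarith) k
    have h5 := hsum K
    simp only [zero_add] at h
    linarith
  · have h := hconst (fun k => u k - (θ1 k - θ0 k) / Δτ) (by
      intro k
      have h1 := hu k
      have h2 := hscheme (k - 1)
      rw [sub_add_cancel] at h2
      rw [← h2] at h1
      have h3 : ((θ1 k - θ1 (k - 1)) - (θ0 k - θ0 (k - 1))) / (Δs * Δτ) * Δs
          = (θ1 k - θ0 k) / Δτ - (θ1 (k - 1) - θ0 (k - 1)) / Δτ := by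
        field_simp
        ring
      rw [h3] at h1
      show u k - (θ1 k - θ0 k) / Δτ = u (k - 1) - (θ1 (k - 1) - θ0 (k - 1)) / Δτ
      linarith)
    have h1 := h (k + K)
    have h2 := h k
    simp only [hper0, hper1, add_sub_add_right_eq_sub] at h1 h2
    linarith
end

section
/- Fix Δτ, Δs > 0, K ≥ 1, n ∈ ℤ, and let θ⁽ᵐ⁾, θ⁽ᵐ⁺¹⁾ : ℤ → ℝ satisfy θ⁽ʲ⁾_{k+K} = θ⁽ʲ⁾ₖ + 2nπ for j ∈ {m, m+1} and all k ∈ ℤ, satisfy θ⁽ᵐ⁺¹⁾ₖ ≠ θ⁽ᵐ⁾ₖ for all k, and solve the average-difference scheme ((θ⁽ᵐ⁺¹⁾ₖ₊₁ − θ⁽ᵐ⁺¹⁾ₖ) − (θ⁽ᵐ⁾ₖ₊₁ − θ⁽ᵐ⁾ₖ))/(Δs·Δτ) = (aₖ₊₁ + aₖ)/2 for all k ∈ ℤ, where aₖ = −(cos θ⁽ᵐ⁺¹⁾ₖ − cos θ⁽ᵐ⁾ₖ)/(θ⁽ᵐ⁺¹⁾ₖ − θ⁽ᵐ⁾ₖ).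 Assume Σ_{k=1}^{K} cos θ⁽ᵐ⁾ₖ ≠ 0 and define u⁽ᵐ⁾₀ := δ⁺_τ θ⁽ᵐ⁾₀ − (Σ_{k=1}^{K} (δ⁺_τ θ⁽ᵐ⁾ₖ)·cos θ⁽ᵐ⁾ₖ · Δs)/(Σ_{k=1}^{K} cos θ⁽ᵐ⁾ₖ · Δs), where δ⁺_τ θ⁽ᵐ⁾ₖ = (θ⁽ᵐ⁺¹⁾ₖ − θ⁽ᵐ⁾ₖ)/Δτ. Let x⁽ᵐ⁾ₖ = x⁽ᵐ⁾₀ + Σ_{i=1}^{k} cos θ⁽ᵐ⁾ᵢ · Δs and u⁽ᵐ⁾ₖ = u⁽ᵐ⁾₀ + Σ_{i=1}^{k} ((aᵢ + aᵢ₋₁)/2) · Δs. Then the discrete implicit constraint Σ_{k=1}^{K} u⁽ᵐ⁾ₖ · (x⁽ᵐ⁾ₖ − x⁽ᵐ⁾ₖ₋₁) = 0 holds. -/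
open Real

/-- For a quasi-periodic solution of the average-difference scheme for the sine-Gordon
equation, with the base point `u₀` chosen as
`u₀ = δ⁺_τ θ⁽ᵐ⁾₀ − (Σₖ (δ⁺_τ θ⁽ᵐ⁾ₖ) cos θ⁽ᵐ⁾ₖ Δs)/(Σₖ cos θ⁽ᵐ⁾ₖ Δs)`, the curve obtained
by the discrete hodograph transformation satisfies the discrete implicit constraint
`Σ_{k=1}^K u⁽ᵐ⁾ₖ (x⁽ᵐ⁾ₖ − x⁽ᵐ⁾ₖ₋₁) = 0`. -/
theorem discrete_implicit_constraint
    (Δτ Δs : ℝ) (hΔτ : 0 < Δτ) (hΔs : 0 < Δs) (K : ℕ) (hK : 1 ≤ K) (n : ℤ)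
    (θ0 θ1 : ℤ → ℝ)
    (hper0 : ∀ k : ℤ, θ0 (k + (K : ℤ)) = θ0 k + 2 * (n : ℝ) * Real.pi)
    (hper1 : ∀ k : ℤ, θ1 (k + (K : ℤ)) = θ1 k + 2 * (n : ℝ) * Real.pi)
    (hne : ∀ k : ℤ, θ1 k ≠ θ0 k)
    (a : ℤ → ℝ)
    (ha : ∀ k : ℤ, a k = -(Real.cos (θ1 k) - Real.cos (θ0 k)) / (θ1 k - θ0 k))
    (hscheme : ∀ k : ℤ,
      ((θ1 (k + 1) - θ1 k) - (θ0 (k + 1) - θ0 k)) / (Δs * Δτ) = (a (k + 1) + a k) / 2)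
    (hcos : (∑ k ∈ Finset.Icc (1 : ℤ) (K : ℤ), Real.cos (θ0 k)) ≠ 0)
    (x u : ℤ → ℝ)
    (hu0 : u 0 = (θ1 0 - θ0 0) / Δτ
      - (∑ k ∈ Finset.Icc (1 : ℤ) (K : ℤ), ((θ1 k - θ0 k) / Δτ) * Real.cos (θ0 k) * Δs)
        / (∑ k ∈ Finset.Icc (1 : ℤ) (K : ℤ), Real.cos (θ0 k) * Δs))
    (hx : ∀ k : ℤ, x k - x (k - 1) = Real.cos (θ0 k) * Δs)
    (hu : ∀ k : ℤ, u k - u (k - 1) = ((a k + a (k - 1)) / 2) * Δs) :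
    ∑ k ∈ Finset.Icc (1 : ℤ) (K : ℤ), u k * (x k - x (k - 1)) = 0 := by
  have hstep : ∀ k : ℤ, u (k + 1) - u k
      = (θ1 (k + 1) - θ0 (k + 1)) / Δτ - (θ1 k - θ0 k) / Δτ := by
    intro k
    have h1 := hu (k + 1)
    rw [add_sub_cancel_right] at h1
    rw [h1, ← hscheme k]
    field_simp
    ring
  obtain ⟨C, hC⟩ : ∃ C : ℝ, C = (∑ k ∈ Finset.Icc (1 : ℤ) (K : ℤ),
      ((θ1 k - θ0 k) / Δτ) * Real.cos (θ0 k) * Δs)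
        / (∑ k ∈ Finset.Icc (1 : ℤ) (K : ℤ), Real.cos (θ0 k) * Δs) := ⟨_, rfl⟩
  rw [← hC] at hu0
  have hform : ∀ j : ℕ, u (j : ℤ) = (θ1 j - θ0 j) / Δτ - C := by
    intro j
    induction j with
    | zero => simpa using hu0
    | succ j ih =>
      have := hstep j
      push_cast
      linarith
  have hden : (∑ k ∈ Finset.Icc (1 : ℤ) (K : ℤ), Real.cos (θ0 k) * Δs) ≠ 0 := by
    rw [← Finset.sum_mul]
    exact mul_ne_zero hcos hΔs.ne'
  rw [eq_div_iff hden] at hC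
  have hsum : ∑ k ∈ Finset.Icc (1 : ℤ) (K : ℤ), u k * (x k - x (k - 1))
      = ∑ k ∈ Finset.Icc (1 : ℤ) (K : ℤ), (((θ1 k - θ0 k) / Δτ) * Real.cos (θ0 k) * Δs
        - C * (Real.cos (θ0 k) * Δs)) := by
    refine Finset.sum_congr rfl fun k hk => ?_
    have hk1 := (Finset.mem_Icc.mp hk).1
    have h := hform k.toNat
    rw [Int.toNat_of_nonneg (by omega)] at h
    rw [hx, h]
    ring
  rw [hsum, Finset.sum_sub_distrib, ← Finset.mul_sum, hC, sub_self]
end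

section
/- Fix Δx > 0 and N ∈ ℕ with N ≥ 1, and let v, w : ℤ → ℝ be N-periodic sequences (v_{k+N} = v_k, w_{k+N} = w_k) with Σ_{k=1}^{N} v_k = 0 and Σ_{k=1}^{N} w_k = 0. Define the discrete antiderivative δ⁻¹_FD v_k := δ̃⁻¹_FD v_k − (1/(N·Δx))·Σ_{ℓ=1}^{N} δ̃⁻¹_FD v_ℓ · Δx, where δ̃⁻¹_FD v_1 := ((v_N + v_1)/2)·Δx and, for 2 ≤ k ≤ N, δ̃⁻¹_FD v_k := (v_N/2 + Σ_{ℓ=1}^{k−1} v_ℓ + v_k/2)·Δx. Then Σ_{k=1}^{N} v_k · δ⁻¹_FD w_k + Σ_{k=1}^{N} w_k · δ⁻¹_FD v_k = 0; in particular, Σ_{k=1}^{N} v_k · δ⁻¹_FD v_k = 0. -/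
open Real

/-- The trapezoidal partial sum `δ̃⁻¹_FD vₖ = (v_N/2 + Σ_{ℓ=1}^{k−1} vₗ + vₖ/2)·Δx`;
for `k = 1` this reduces to `((v_N + v₁)/2)·Δx`. -/
noncomputable def tildeFD (N : ℕ) (Δx : ℝ) (v : ℤ → ℝ) (k : ℤ) : ℝ :=
  (v (N : ℤ) / 2 + (∑ l ∈ Finset.Icc (1 : ℤ) (k - 1), v l) + v k / 2) * Δx

/-- The zero-mean discrete antiderivative
`δ⁻¹_FD vₖ = δ̃⁻¹_FD vₖ − (1/(NΔx))·Σ_{ℓ=1}^N δ̃⁻¹_FD vₗ · Δx`,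
extended `N`-periodically to all `k ∈ ℤ`. -/
noncomputable def fdInv (N : ℕ) (Δx : ℝ) (v : ℤ → ℝ) (k : ℤ) : ℝ :=
  tildeFD N Δx v ((k - 1) % (N : ℤ) + 1)
    - (1 / ((N : ℝ) * Δx)) * ∑ l ∈ Finset.Icc (1 : ℤ) (N : ℤ), tildeFD N Δx v l * Δx

theorem Icc_succ_sum (f : ℤ → ℝ) (n : ℕ) :
    ∑ k ∈ Finset.Icc (1 : ℤ) ((n + 1 : ℕ) : ℤ), f k
      = (∑ k ∈ Finset.Icc (1 : ℤ) (n : ℤ), f k) + f ((n : ℤ) + 1) := by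
  have h : Finset.Icc (1 : ℤ) ((n + 1 : ℕ) : ℤ)
      = insert ((n : ℤ) + 1) (Finset.Icc (1 : ℤ) (n : ℤ)) := by
    ext x
    simp only [Finset.mem_Icc, Finset.mem_insert]
    push_cast
    omega
  rw [h, Finset.sum_insert (by simp), add_comm]

theorem parts_sum (v w : ℤ → ℝ) (n : ℕ) :
    ∑ k ∈ Finset.Icc (1 : ℤ) (n : ℤ),
      (v k * ((∑ l ∈ Finset.Icc (1 : ℤ) (k - 1), w l) + w k / 2)
        + w k * ((∑ l ∈ Finset.Icc (1 : ℤ) (k - 1), v l) + v k / 2))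
      = (∑ k ∈ Finset.Icc (1 : ℤ) (n : ℤ), v k) * ∑ k ∈ Finset.Icc (1 : ℤ) (n : ℤ), w k := by
  induction n with
  | zero => simp
  | succ n ih =>
    rw [Icc_succ_sum, Icc_succ_sum, Icc_succ_sum, ih, add_sub_cancel_right]
    ring

theorem skew_aux (Δx : ℝ) (N : ℕ) (v w : ℤ → ℝ)
    (hv0 : ∑ k ∈ Finset.Icc (1 : ℤ) (N : ℤ), v k = 0)
    (hw0 : ∑ k ∈ Finset.Icc (1 : ℤ) (N : ℤ), w k = 0) :
    (∑ k ∈ Finset.Icc (1 : ℤ) (N : ℤ), v k * fdInv N Δx w k)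
        + (∑ k ∈ Finset.Icc (1 : ℤ) (N : ℤ), w k * fdInv N Δx v k) = 0 := by
  have key : ∀ u : ℤ → ℝ, ∃ c : ℝ, ∀ k ∈ Finset.Icc (1 : ℤ) (N : ℤ),
      fdInv N Δx u k
        = Δx * ((∑ l ∈ Finset.Icc (1 : ℤ) (k - 1), u l) + u k / 2) + c := by
    intro u
    refine ⟨u (N : ℤ) / 2 * Δx - (1 / ((N : ℝ) * Δx)) *
      ∑ l ∈ Finset.Icc (1 : ℤ) (N : ℤ), tildeFD N Δx u l * Δx, fun k hk => ?_⟩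
    rw [Finset.mem_Icc] at hk
    have h : (k - 1) % (N : ℤ) + 1 = k := by
      rw [Int.emod_eq_of_lt (by omega) (by omega)]
      omega
    rw [fdInv, h]
    conv_lhs => rw [tildeFD]
    ring
  obtain ⟨c, hc⟩ := key w
  obtain ⟨d, hd⟩ := key v
  have hp := parts_sum v w N
  rw [hv0, zero_mul] at hp
  calc _ = ∑ k ∈ Finset.Icc (1 : ℤ) (N : ℤ),
      (Δx * (v k * ((∑ l ∈ Finset.Icc (1 : ℤ) (k - 1), w l) + w k / 2)
        + w k * ((∑ l ∈ Finset.Icc (1 : ℤ) (k - 1), v l) + v k / 2))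
        + (c * v k + d * w k)) := by
        rw [← Finset.sum_add_distrib]
        refine Finset.sum_congr rfl fun k hk => ?_
        rw [hc k hk, hd k hk]
        ring
    _ = 0 := by
        rw [Finset.sum_add_distrib, Finset.sum_add_distrib, ← Finset.mul_sum,
          ← Finset.mul_sum, ← Finset.mul_sum, hp, hv0, hw0]
        ring

/-- Skew-symmetry of the discrete antiderivative `δ⁻¹_FD` on zero-mean `N`-periodic
sequences: `Σ vₖ δ⁻¹_FD wₖ + Σ wₖ δ⁻¹_FD vₖ = 0`; in particular `Σ vₖ δ⁻¹_FD vₖ = 0`. -/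
theorem fdInv_skew_symmetric
    (Δx : ℝ) (hΔx : 0 < Δx) (N : ℕ) (hN : 1 ≤ N)
    (v w : ℤ → ℝ)
    (hvper : ∀ k : ℤ, v (k + (N : ℤ)) = v k)
    (hwper : ∀ k : ℤ, w (k + (N : ℤ)) = w k)
    (hv0 : ∑ k ∈ Finset.Icc (1 : ℤ) (N : ℤ), v k = 0)
    (hw0 : ∑ k ∈ Finset.Icc (1 : ℤ) (N : ℤ), w k = 0) :
    (∑ k ∈ Finset.Icc (1 : ℤ) (N : ℤ), v k * fdInv N Δx w k)
        + (∑ k ∈ Finset.Icc (1 : ℤ) (N : ℤ), w k * fdInv N Δx v k) = 0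
      ∧ ∑ k ∈ Finset.Icc (1 : ℤ) (N : ℤ), v k * fdInv N Δx v k = 0 := by
  refine ⟨skew_aux Δx N v w hv0 hw0, ?_⟩
  have h := skew_aux Δx N v v hv0 hv0
  linarith
end

section
/- Fix Δx, Δt > 0 and N ≥ 1, and let u⁽ᵐ⁾, u⁽ᵐ⁺¹⁾ : ℤ → ℝ be N-periodic sequences solving the difference scheme δ⁺_x δ⁺_t u⁽ᵐ⁾ₖ = μ⁺_x μ⁺_t u⁽ᵐ⁾ₖ + δ⁺_x( (δ⁽¹⁾_x μ⁺_t u⁽ᵐ⁾ₖ)·μ⁺_x( (μ⁺_t u⁽ᵐ⁾ₖ)·(μ⁺_t u⁽ᵐ⁾ₖ₋₁)/2 ) ) for all k ∈ ℤ, where δ⁺_x vₖ = (vₖ₊₁ − vₖ)/Δx, μ⁺_x vₖ = (vₖ₊₁ + vₖ)/2, δ⁺_t u⁽ᵐ⁾ₖ = (u⁽ᵐ⁺¹⁾ₖ − u⁽ᵐ⁾ₖ)/Δt, μ⁺_t u⁽ᵐ⁾ₖ = (u⁽ᵐ⁺¹⁾ₖ + u⁽ᵐ⁾ₖ)/2,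 and δ⁽¹⁾_x vₖ = (vₖ₊₁ − vₖ₋₁)/(2Δx). Then Σ_{k=1}^{N} u⁽ᵐ⁺¹⁾ₖ = −Σ_{k=1}^{N} u⁽ᵐ⁾ₖ; in particular, if Σ_{k=1}^{N} u⁽ᵐ⁾ₖ = 0, then Σ_{k=1}^{N} u⁽ᵐ⁺¹⁾ₖ = 0. -/
open Real

/-- The temporal average `μ⁺_t u⁽ᵐ⁾ₖ = (u⁽ᵐ⁺¹⁾ₖ + u⁽ᵐ⁾ₖ)/2`. -/
noncomputable def muT (u0 u1 : ℤ → ℝ) (k : ℤ) : ℝ := (u1 k + u0 k) / 2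

/-- The quantity `(δ⁽¹⁾_x μ⁺_t u⁽ᵐ⁾ₖ)·μ⁺_x((μ⁺_t u⁽ᵐ⁾ₖ)(μ⁺_t u⁽ᵐ⁾ₖ₋₁)/2)` appearing in the
rewritten norm-preserving scheme, where `δ⁽¹⁾_x vₖ = (vₖ₊₁ − vₖ₋₁)/(2Δx)` and
`μ⁺_x vₖ = (vₖ₊₁ + vₖ)/2`. -/
noncomputable def fluxG (Δx : ℝ) (u0 u1 : ℤ → ℝ) (k : ℤ) : ℝ :=
  ((muT u0 u1 (k + 1) - muT u0 u1 (k - 1)) / (2 * Δx))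
    * ((muT u0 u1 (k + 1) * muT u0 u1 k / 2 + muT u0 u1 k * muT u0 u1 (k - 1) / 2) / 2)

theorem tele_aux (F : ℤ → ℝ) (n : ℕ) :
    ∑ k ∈ Finset.Icc (1 : ℤ) (n : ℤ), (F (k + 1) - F k) = F ((n : ℤ) + 1) - F 1 := by
  induction n with
  | zero => simp
  | succ n ih =>
    have h : Finset.Icc (1 : ℤ) ((n + 1 : ℕ) : ℤ)
        = insert ((n : ℤ) + 1) (Finset.Icc (1 : ℤ) (n : ℤ)) := by
      ext x
      simp only [Finset.mem_Icc, Finset.mem_insert]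
      omega
    rw [h, Finset.sum_insert (by simp), ih]
    push_cast
    ring

/-- For `N`-periodic solutions of the rewritten norm-preserving scheme
`δ⁺_x δ⁺_t u⁽ᵐ⁾ₖ = μ⁺_x μ⁺_t u⁽ᵐ⁾ₖ + δ⁺_x((δ⁽¹⁾_x μ⁺_t u⁽ᵐ⁾ₖ)·μ⁺_x((μ⁺_t u⁽ᵐ⁾ₖ)(μ⁺_t u⁽ᵐ⁾ₖ₋₁)/2))`,
one has `Σ u⁽ᵐ⁺¹⁾ₖ = −Σ u⁽ᵐ⁾ₖ`; in particular zero mean is preserved. -/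
theorem scheme_flips_mean
    (Δx Δt : ℝ) (hΔx : 0 < Δx) (hΔt : 0 < Δt) (N : ℕ) (hN : 1 ≤ N)
    (u0 u1 : ℤ → ℝ)
    (hper0 : ∀ k : ℤ, u0 (k + (N : ℤ)) = u0 k)
    (hper1 : ∀ k : ℤ, u1 (k + (N : ℤ)) = u1 k)
    (hscheme : ∀ k : ℤ,
      ((u1 (k + 1) - u0 (k + 1)) - (u1 k - u0 k)) / (Δx * Δt)
        = (muT u0 u1 (k + 1) + muT u0 u1 k) / 2
          + (fluxG Δx u0 u1 (k + 1) - fluxG Δx u0 u1 k) / Δx) :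
    (∑ k ∈ Finset.Icc (1 : ℤ) (N : ℤ), u1 k)
        = -∑ k ∈ Finset.Icc (1 : ℤ) (N : ℤ), u0 k
      ∧ ((∑ k ∈ Finset.Icc (1 : ℤ) (N : ℤ), u0 k) = 0 →
          (∑ k ∈ Finset.Icc (1 : ℤ) (N : ℤ), u1 k) = 0) := by
  have key : ∑ k ∈ Finset.Icc (1 : ℤ) (N : ℤ), (u1 k + u0 k) = 0 := by
    let F : ℤ → ℝ := fun k => 2 * ((u1 k - u0 k) / (Δx * Δt) - fluxG Δx u0 u1 k / Δx
      - muT u0 u1 k / 2)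
    have hF : ∀ k, u1 k + u0 k = F (k + 1) - F k := by
      intro k
      have h := hscheme k
      have h2 : muT u0 u1 k = (u1 k + u0 k) / 2 := rfl
      rw [sub_div, sub_div (fluxG Δx u0 u1 (k + 1))] at h
      simp only [F]
      linarith
    rw [Finset.sum_congr rfl (fun k _ => hF k), tele_aux]
    have hm : ∀ k, muT u0 u1 (k + N) = muT u0 u1 k := by
      intro k
      simp only [muT, hper0, hper1]
    have hg : ∀ k, fluxG Δx u0 u1 (k + N) = fluxG Δx u0 u1 k := by
      intro k
      have e1 : k + (N : ℤ) + 1 = (k + 1) + N := by ring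
      have e2 : k + (N : ℤ) - 1 = (k - 1) + N := by ring
      simp only [fluxG, e1, e2, hm]
    rw [add_comm (N : ℤ) 1]
    simp only [F, hm, hg, hper0, hper1, sub_self]
  rw [Finset.sum_add_distrib] at key
  exact ⟨by linarith, fun h => by linarith⟩
end

section
/- Fix Δx > 0 and N ≥ 1, and let v : ℤ → ℝ be an N-periodic sequence with Σ_{k=1}^{N} v_k = 0. Define δ⁻¹_FD v_k := δ̃⁻¹_FD v_k − (1/(N·Δx))·Σ_{ℓ=1}^{N} δ̃⁻¹_FD v_ℓ · Δx, where δ̃⁻¹_FD v_1 := ((v_N + v_1)/2)·Δx and δ̃⁻¹_FD v_k := (v_N/2 + Σ_{ℓ=1}^{k−1} v_ℓ + v_k/2)·Δx for 2 ≤ k ≤ N, extended N-periodically to all k ∈ ℤ. Then the identities δ⁺_x(δ⁻¹_FD v)_k = μ⁺_x v_k hold for all k, where δ⁺_x wₖ = (wₖ₊₁ − wₖ)/Δx and μ⁺_x wₖ = (wₖ₊₁ + wₖ)/2. -/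
open Real

/-- For zero-mean `N`-periodic sequences, the discrete antiderivative satisfies
`δ⁺_x(δ⁻¹_FD v)ₖ = μ⁺_x vₖ` for all `k`, where `δ⁺_x wₖ = (wₖ₊₁ − wₖ)/Δx` and
`μ⁺_x wₖ = (wₖ₊₁ + wₖ)/2`. -/
theorem fdInv_forward_difference
    (Δx : ℝ) (hΔx : 0 < Δx) (N : ℕ) (hN : 1 ≤ N)
    (v : ℤ → ℝ)
    (hvper : ∀ k : ℤ, v (k + (N : ℤ)) = v k)
    (hv0 : ∑ k ∈ Finset.Icc (1 : ℤ) (N : ℤ), v k = 0) :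
    ∀ k : ℤ, (fdInv N Δx v (k + 1) - fdInv N Δx v k) / Δx = (v (k + 1) + v k) / 2 := by
  intro k
  have hNpos : (0 : ℤ) < N := by exact_mod_cast hN
  have hper : Function.Periodic v (N : ℤ) := hvper
  have step : ∀ m : ℤ, 0 ≤ m → ∑ l ∈ Finset.Icc (1 : ℤ) (m + 1), v l
      = ∑ l ∈ Finset.Icc (1 : ℤ) m, v l + v (m + 1) := by
    intro m hm
    have h : Finset.Icc (1 : ℤ) (m + 1) = insert (m + 1) (Finset.Icc (1 : ℤ) m) := by
      ext x
      simp only [Finset.mem_Icc, Finset.mem_insert]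
      omega
    rw [h, Finset.sum_insert (by simp), add_comm]
  obtain ⟨r, hr⟩ : ∃ r, r = (k - 1) % (N : ℤ) := ⟨_, rfl⟩
  obtain ⟨q, hq⟩ : ∃ q, q = (k - 1) / (N : ℤ) := ⟨_, rfl⟩
  have hr0 : 0 ≤ r := hr ▸ Int.emod_nonneg _ hNpos.ne'
  have hrN : r < N := hr ▸ Int.emod_lt_of_pos _ hNpos
  have hk : k = r + 1 + q * N := by
    have := Int.emod_add_mul_ediv (k - 1) (N : ℤ)
    rw [← hr, ← hq] at this
    linarith
  have hv1 : v k = v (r + 1) := by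
    rw [hk]; exact hper.int_mul q (r + 1)
  have hv2 : v (k + 1) = v (r + 1 + 1) := by
    rw [hk, show r + 1 + q * (N : ℤ) + 1 = (r + 1 + 1) + q * N by ring]
    exact hper.int_mul q (r + 1 + 1)
  have hs := step r hr0
  have hmod : (k + 1 - 1) % (N : ℤ) = (r + 1) % N := by
    rw [hk, show r + 1 + q * (N : ℤ) + 1 - 1 = (r + 1) + q * N by ring, Int.add_mul_emod_self_right]
  rw [div_eq_iff hΔx.ne', hv1, hv2]
  unfold fdInv
  rw [hmod, ← hr]
  unfold tildeFD
  rcases lt_or_eq_of_le (show r + 1 ≤ (N : ℤ) by omega) with h | h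
  · rw [Int.emod_eq_of_lt (by omega) h]
    simp only [add_sub_cancel_right]
    rw [hs]
    ring
  · have h1 : v (r + 1 + 1) = v 1 := by
      rw [h, add_comm]; exact hvper 1
    rw [← h] at hv0
    rw [hs] at hv0
    rw [h1, ← h, Int.emod_self]
    simp only [add_sub_cancel_right, zero_add]
    have h2 : ∑ l ∈ Finset.Icc (1 : ℤ) r, v l = - v (r + 1) := by linarith
    rw [h2]
    simp
    ring
end
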